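/- arXiv:2403.07686 — 2 statements merged into one kernel-verified Lean document; each statement's English description precedes it below -/
import Mathlib

section
/- Let X and Y be diagrammatically fibrant stratified spaces over a poset P and w : X → Y a stratified map. Then w is a diagrammatic equivalence if and only if for each p ∈ P the restriction w_p : X_p → Y_p is a weak homotopy equivalence and for each x ∈ X_p the induced map of local homotopy links Hol^s_p(X)_x → Hol^s_p(Y)_{w(x)} is a diagrammatic equivalence over P_{>p}. If moreover X and Y are categorically fibrant, these conditions are further equivalent to: each w_p is a weak homotopy equivalence and for each x ∈ X_p the induced map of local homotopy links Hol^s_p(X)_x → Hol^s_p(Y)_{w(x)} restricts to a weak homotopy equivalence on each stratum. -/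
open Set unitInterval

noncomputable section

/-! ### Stratified spaces over a poset -/

/-- Continuity into the Alexandrov topology on a preordered set: preimages of
upper sets are open. -/
def AlexContinuous {P : Type*} [Preorder P] {X : Type*} [TopologicalSpace X] (s : X → P) : Prop :=
  ∀ U : Set P, IsUpperSet U → IsOpen (s ⁻¹' U)

lemma stdSimplex.exists_pos' {n : ℕ} (x : stdSimplex ℝ (Fin (n + 1))) :
    ∃ i, 0 < (x : Fin (n + 1) → ℝ) i := by
  by_contra h
  push_neg at h
  have h1 : ∑ i, (x : Fin (n + 1) → ℝ) i = 1 := x.2.2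
  have h2 : ∑ i, (x : Fin (n + 1) → ℝ) i ≤ 0 := Finset.sum_nonpos fun i _ => h i
  linarith

/-- The largest index with positive barycentric coordinate. -/
def maxSupp {n : ℕ} (x : stdSimplex ℝ (Fin (n + 1))) : Fin (n + 1) :=
  (Finset.univ.filter fun i => 0 < (x : Fin (n + 1) → ℝ) i).max' (by
    obtain ⟨i, hi⟩ := stdSimplex.exists_pos' x
    exact ⟨i, Finset.mem_filter.2 ⟨Finset.mem_univ i, hi⟩⟩)

/-- The stratification of the realized stratified simplex `|Δ^J|` of a flag `J`. -/
def flagStrat {P : Type*} {n : ℕ} (J : Fin (n + 1) → P) (x : stdSimplex ℝ (Fin (n + 1))) : P :=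
  J (maxSupp x)

/-- The `k`-th horn of the standard `n`-simplex, as a subset of the simplex. -/
def hornSet (n : ℕ) (k : Fin (n + 1)) : Set (stdSimplex ℝ (Fin (n + 1))) :=
  {x | ∃ i, i ≠ k ∧ (x : Fin (n + 1) → ℝ) i = 0}

/-- `X` (stratified by `s`) has the horn filling property with respect to the
realized stratified horn inclusion `|Λ^J_k| ↪ |Δ^J|`. -/
def HornFilling {P : Type*} {X : Type*} [TopologicalSpace X] (s : X → P) {n : ℕ}
    (J : Fin (n + 1) → P) (k : Fin (n + 1)) : Prop :=
  ∀ f : hornSet n k → X, Continuous f →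
    (∀ y : hornSet n k, s (f y) = flagStrat J y.1) →
    ∃ g : stdSimplex ℝ (Fin (n + 1)) → X, Continuous g ∧
      (∀ x, s (g x) = flagStrat J x) ∧ ∀ y : hornSet n k, g y.1 = f y

/-- `(J, k)` is an inner horn datum. -/
def IsInner (n : ℕ) (k : Fin (n + 1)) : Prop := 0 < (k : ℕ) ∧ (k : ℕ) < n

/-- `(J, k)` is an admissible horn datum. -/
def IsAdmissible {P : Type*} {n : ℕ} (J : Fin (n + 1) → P) (k : Fin (n + 1)) : Prop :=
  IsInner n k ∨
    ((k : ℕ) = 0 ∧ ∃ h : 0 < n, J ⟨0, Nat.succ_pos n⟩ = J ⟨1, Nat.succ_lt_succ h⟩) ∨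
    ((k : ℕ) = n ∧ ∃ _h : 0 < n, J ⟨n - 1, by omega⟩ = J ⟨n, Nat.lt_succ_self n⟩)

/-- A stratified space is categorically fibrant if it has the horn filling property
with respect to all inner stratified horn inclusions. -/
def CatFibrant {P : Type*} [Preorder P] {X : Type*} [TopologicalSpace X] (s : X → P) : Prop :=
  ∀ (n : ℕ) (J : Fin (n + 1) → P), Monotone J → ∀ k : Fin (n + 1), IsInner n k → HornFilling s J k

/-- A stratified space is diagrammatically fibrant if it has the horn filling property
with respect to all admissible stratified horn inclusions. -/
def DiagFibrant {P : Type*} [Preorder P] {X : Type*} [TopologicalSpace X] (s : X → P) : Prop :=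
  ∀ (n : ℕ) (J : Fin (n + 1) → P), Monotone J → ∀ k : Fin (n + 1), IsAdmissible J k →
    HornFilling s J k

/-! ### Exit paths and refinedness -/

/-- An exit path: `s ∘ γ` is constant on `(0, 1]` and does not decrease from `γ 0`. -/
def IsExitPath {P : Type*} [Preorder P] {X : Type*} [TopologicalSpace X]
    (s : X → P) (γ : C(I, X)) : Prop :=
  (∀ t t' : I, t ≠ 0 → t' ≠ 0 → s (γ t) = s (γ t')) ∧ ∀ t : I, s (γ 0) ≤ s (γ t)

/-- One step in a chain of exit paths. -/
def ExitStep {P : Type*} [Preorder P] {X : Type*} [TopologicalSpace X] (s : X → P)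
    (x y : X) : Prop :=
  ∃ γ : C(I, X), IsExitPath s γ ∧ γ 0 = x ∧ γ 1 = y

/-- A stratified space is refined if its stratification is surjective and the order
relation is exactly detected by finite chains of exit paths. -/
def IsRefined {P : Type*} [Preorder P] {X : Type*} [TopologicalSpace X] (s : X → P) : Prop :=
  Function.Surjective s ∧ ∀ x y : X, s x ≤ s y ↔ Relation.ReflTransGen (ExitStep s) x y

/-- The frontier relation: the `p`-stratum meets the closure of the `q`-stratum. -/
def FrontierRel {P : Type*} {X : Type*} [TopologicalSpace X] (s : X → P) (p q : P) : Prop :=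
  (s ⁻¹' {p} ∩ closure (s ⁻¹' {q})).Nonempty

/-- Weakly frontier stratified. -/
def WeaklyFrontierStratified {P : Type*} [Preorder P] {X : Type*} [TopologicalSpace X]
    (s : X → P) : Prop :=
  Function.Surjective s ∧ ∀ p q : P, p ≤ q ↔ Relation.ReflTransGen (FrontierRel s) p q

/-- Frontier stratified. -/
def FrontierStratified {P : Type*} [Preorder P] {X : Type*} [TopologicalSpace X]
    (s : X → P) : Prop :=
  WeaklyFrontierStratified s ∧ ∀ p q : P, FrontierRel s p q → s ⁻¹' {p} ⊆ closure (s ⁻¹' {q})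

/-! ### Homotopy links -/

lemma I_one_ne_zero : (1 : I) ≠ 0 := fun h => one_ne_zero (α := ℝ) (congrArg Subtype.val h)

/-- The pairwise homotopy link of the pair of strata `p`, `q`. -/
abbrev PairHolink {P : Type*} {X : Type*} [TopologicalSpace X] (s : X → P) (p q : P) :=
  {γ : C(I, X) // s (γ 0) = p ∧ ∀ t : I, t ≠ 0 → s (γ t) = q}

/-- Starting point evaluation on the pairwise homotopy link. -/
def pairHolinkEv0 {P : Type*} {X : Type*} [TopologicalSpace X] (s : X → P) (p q : P)
    (γ : PairHolink s p q) : {x : X // s x = p} :=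
  ⟨γ.1 0, γ.2.1⟩

/-- A Serre fibration: a map with the homotopy lifting property with respect to all
Euclidean disks. -/
def IsSerreFibration {E B : Type*} [TopologicalSpace E] [TopologicalSpace B] (π : E → B) : Prop :=
  ∀ (n : ℕ)
    (H : ↥(Metric.closedBall (0 : EuclideanSpace ℝ (Fin n)) 1) × I → B)
    (h₀ : ↥(Metric.closedBall (0 : EuclideanSpace ℝ (Fin n)) 1) → E),
    Continuous H → Continuous h₀ → (∀ d, π (h₀ d) = H (d, 0)) →
    ∃ G : ↥(Metric.closedBall (0 : EuclideanSpace ℝ (Fin n)) 1) × I → E,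
      Continuous G ∧ (∀ d, G (d, 0) = h₀ d) ∧ ∀ z, π (G z) = H z

/-- The stratified homotopy link of the stratum `p`: exit paths starting in the
`p`-stratum and immediately leaving it. -/
abbrev StratHolink {P : Type*} [Preorder P] {X : Type*} [TopologicalSpace X]
    (s : X → P) (p : P) :=
  {γ : C(I, X) // s (γ 0) = p ∧ (∀ t : I, t ≠ 0 → p < s (γ t)) ∧
    ∀ t t' : I, t ≠ 0 → t' ≠ 0 → s (γ t) = s (γ t')}

/-- The stratification of the stratified homotopy link over `P_{>p}`. -/
def stratHolinkStrat {P : Type*} [Preorder P] {X : Type*} [TopologicalSpace X]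
    (s : X → P) (p : P) (γ : StratHolink s p) : {q : P // p < q} :=
  ⟨s (γ.1 1), γ.2.2.1 1 I_one_ne_zero⟩

/-- Endpoint evaluation on the stratified homotopy link. -/
def stratHolinkEv1 {P : Type*} [Preorder P] {X : Type*} [TopologicalSpace X]
    (s : X → P) (p : P) (γ : StratHolink s p) : {x : X // p < s x} :=
  ⟨γ.1 1, γ.2.2.1 1 I_one_ne_zero⟩

/-- The generalized homotopy link of a (regular) flag `Iflag`: the space of stratified
maps `|Δ^Iflag| → X`, topologized via the compact-open topology. -/
abbrev Holink {P : Type*} {X : Type*} [TopologicalSpace X] (s : X → P) {m : ℕ}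
    (Iflag : Fin (m + 1) → P) :=
  {f : C(stdSimplex ℝ (Fin (m + 1)), X) // ∀ x, s (f x) = flagStrat Iflag x}

/-! ### Weak homotopy equivalences -/

/-- The boundary of the `n`-cube. -/
def cubeBoundary (n : ℕ) : Set (Fin n → I) := {y | ∃ i, y i = 0 ∨ y i = 1}

/-- Generalized loops: maps of the `n`-cube collapsing the boundary to the basepoint. -/
abbrev GenLoops (n : ℕ) (X : Type*) [TopologicalSpace X] (x : X) :=
  {p : C((Fin n → I), X) // ∀ y ∈ cubeBoundary n, p y = x}

/-- Homotopy rel boundary as a setoid on generalized loops. -/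
def genLoopSetoid (n : ℕ) (X : Type*) [TopologicalSpace X] (x : X) :
    Setoid (GenLoops n X x) where
  r p q := p.1.HomotopicRel q.1 (cubeBoundary n)
  iseqv := ⟨fun p => ContinuousMap.HomotopicRel.refl p.1,
    fun h => h.symm, fun h h' => h.trans h'⟩

/-- The `n`-th homotopy group (as a type) of `X` at `x`. -/
def HtpyGroup (n : ℕ) (X : Type*) [TopologicalSpace X] (x : X) :=
  Quotient (genLoopSetoid n X x)

/-- The map induced by a continuous map on homotopy groups. -/
def htpyGroupMap (n : ℕ) {X Y : Type*} [TopologicalSpace X] [TopologicalSpace Y]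
    (f : C(X, Y)) (x : X) : HtpyGroup n X x → HtpyGroup n Y (f x) :=
  Quotient.map (fun p => ⟨f.comp p.1, fun y hy => by
      simp [ContinuousMap.comp_apply, p.2 y hy]⟩)
    (fun p q h => h.map fun F => F.compContinuousMap f)

/-- The map induced by a continuous map on path components. -/
def pi0Map {X Y : Type*} [TopologicalSpace X] [TopologicalSpace Y] (f : C(X, Y)) :
    ZerothHomotopy X → ZerothHomotopy Y :=
  Quotient.map f fun _ _ h => ⟨h.somePath.map f.continuous⟩

/-- A weak homotopy equivalence: a continuous map inducing a bijection on path
components and isomorphisms on all homotopy groups at all basepoints. -/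
def IsWeakHomotopyEquiv {X Y : Type*} [TopologicalSpace X] [TopologicalSpace Y]
    (f : C(X, Y)) : Prop :=
  Function.Bijective (pi0Map f) ∧
    ∀ (n : ℕ) (x : X), Function.Bijective (htpyGroupMap (n + 1) f x)

/-! ### Induced maps and diagrammatic equivalences -/

/-- The map induced on generalized homotopy links by a stratified map. -/
def holinkCMap {P : Type*} {X Y : Type*} [TopologicalSpace X] [TopologicalSpace Y]
    (sX : X → P) (sY : Y → P) (w : C(X, Y)) (hw : ∀ x, sY (w x) = sX x)
    {m : ℕ} (Iflag : Fin (m + 1) → P) :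
    C(Holink sX Iflag, Holink sY Iflag) :=
  ⟨fun f => ⟨w.comp f.1, fun x => by simp [ContinuousMap.comp_apply, hw, f.2 x]⟩,
    Continuous.subtype_mk
      ((ContinuousMap.continuous_postcomp w).comp continuous_subtype_val) _⟩

/-- A stratified map is a diagrammatic equivalence if it induces weak homotopy
equivalences on all generalized homotopy links. -/
def IsDiagEquiv {P : Type*} [Preorder P] {X Y : Type*} [TopologicalSpace X] [TopologicalSpace Y]
    (sX : X → P) (sY : Y → P) (w : C(X, Y)) (hw : ∀ x, sY (w x) = sX x) : Prop :=
  ∀ (m : ℕ) (Iflag : Fin (m + 1) → P), StrictMono Iflag →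
    IsWeakHomotopyEquiv (holinkCMap sX sY w hw Iflag)

/-- The restriction of a stratified map to the `q`-stratum. -/
def stratumCMap {Q : Type*} {X Y : Type*} [TopologicalSpace X] [TopologicalSpace Y]
    (sX : X → Q) (sY : Y → Q) (w : C(X, Y)) (hw : ∀ x, sY (w x) = sX x) (q : Q) :
    C({x : X // sX x = q}, {y : Y // sY y = q}) :=
  ⟨fun x => ⟨w x.1, by rw [hw x.1]; exact x.2⟩,
    Continuous.subtype_mk (w.continuous.comp continuous_subtype_val)
      fun x => by show sY (w x.1) = q; rw [hw x.1]; exact x.2⟩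

/-- The map induced on stratified homotopy links by a stratified map. -/
def stratHolinkCMap {P : Type*} [Preorder P] {X Y : Type*} [TopologicalSpace X]
    [TopologicalSpace Y] {sX : X → P} {sY : Y → P} (w : C(X, Y))
    (hw : ∀ x, sY (w x) = sX x) (p : P) :
    C(StratHolink sX p, StratHolink sY p) :=
  ⟨fun γ => ⟨w.comp γ.1,
      by simpa [ContinuousMap.comp_apply, hw] using γ.2.1,
      fun t ht => by simpa [ContinuousMap.comp_apply, hw] using γ.2.2.1 t ht,
      fun t t' ht ht' => by simpa [ContinuousMap.comp_apply, hw] using γ.2.2.2 t t' ht ht'⟩,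
    Continuous.subtype_mk
      ((ContinuousMap.continuous_postcomp w).comp continuous_subtype_val) _⟩

lemma stratHolinkCMap_strat {P : Type*} [Preorder P] {X Y : Type*} [TopologicalSpace X]
    [TopologicalSpace Y] {sX : X → P} {sY : Y → P} (w : C(X, Y))
    (hw : ∀ x, sY (w x) = sX x) (p : P) (γ : StratHolink sX p) :
    stratHolinkStrat sY p (stratHolinkCMap w hw p γ) = stratHolinkStrat sX p γ :=
  Subtype.ext (hw _)

/-- The local homotopy link of `X` at `x ∈ X_p`: the fiber of the stratified homotopy
link over `x`. -/
abbrev LocalHolink {P : Type*} [Preorder P] {X : Type*} [TopologicalSpace X]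
    (s : X → P) (p : P) (x : X) :=
  {γ : StratHolink s p // (γ.1 : C(I, X)) 0 = x}

/-- The stratification of the local homotopy link over `P_{>p}`. -/
def localHolinkStrat {P : Type*} [Preorder P] {X : Type*} [TopologicalSpace X]
    (s : X → P) (p : P) (x : X) (γ : LocalHolink s p x) : {q : P // p < q} :=
  stratHolinkStrat s p γ.1

/-- The map induced on local homotopy links by a stratified map. -/
def localHolinkCMap {P : Type*} [Preorder P] {X Y : Type*} [TopologicalSpace X]
    [TopologicalSpace Y] {sX : X → P} {sY : Y → P} (w : C(X, Y))
    (hw : ∀ x, sY (w x) = sX x) (p : P) (x : X) :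
    C(LocalHolink sX p x, LocalHolink sY p (w x)) :=
  ⟨fun γ => ⟨stratHolinkCMap w hw p γ.1, by
      show (w.comp γ.1.1) 0 = w x
      simp [ContinuousMap.comp_apply, γ.2]⟩,
    Continuous.subtype_mk
      ((stratHolinkCMap w hw p).continuous.comp continuous_subtype_val)
      fun γ => by
        show (w.comp γ.1.1) 0 = w x
        simp [ContinuousMap.comp_apply, γ.2]⟩

lemma localHolinkCMap_strat {P : Type*} [Preorder P] {X Y : Type*} [TopologicalSpace X]
    [TopologicalSpace Y] {sX : X → P} {sY : Y → P} (w : C(X, Y))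
    (hw : ∀ x, sY (w x) = sX x) (p : P) (x : X) (γ : LocalHolink sX p x) :
    localHolinkStrat sY p (w x) (localHolinkCMap w hw p x γ) = localHolinkStrat sX p x γ :=
  Subtype.ext (hw _)

end

/-! ### Path spaces -/

namespace Path

variable {X Y Z : Type} [TopologicalSpace X] [TopologicalSpace Y] [TopologicalSpace Z]

/-- The map induced by `f` on path spaces, with prescribed images of the endpoints. -/
def pmap (f : C(X, Y)) {x x' : X} {y y' : Y} (h : f x = y) (h' : f x' = y') :
    C(Path x x', Path y y') where
  toFun γ := (γ.map f.continuous).cast h.symm h'.symm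
  continuous_toFun := continuous_induced_rng.2
    ((ContinuousMap.continuous_postcomp f).comp continuous_induced_dom)

@[simp] lemma pmap_apply (f : C(X, Y)) {x x' : X} {y y' : Y} (h : f x = y) (h' : f x' = y')
    (γ : Path x x') (t : I) : pmap f h h' γ t = f (γ t) := rfl

lemma pmap_trans (f : C(X, Y)) {x x' x'' : X} {y y' y'' : Y} (h : f x = y) (h' : f x' = y')
    (h'' : f x'' = y'') (γ : Path x x') (δ : Path x' x'') :
    pmap f h h'' (γ.trans δ) = (pmap f h h' γ).trans (pmap f h' h'' δ) := by
  subst h h' h''; exact Path.map_trans γ δ f.continuous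

lemma pmap_symm (f : C(X, Y)) {x x' : X} {y y' : Y} (h : f x = y) (h' : f x' = y')
    (γ : Path x x') : pmap f h' h γ.symm = (pmap f h h' γ).symm := by
  subst h h'; exact Path.map_symm γ f.continuous

lemma pmap_refl (f : C(X, Y)) {x : X} {y : Y} (h : f x = y) :
    pmap f h h (Path.refl x) = Path.refl y := by
  ext t; exact h

lemma Homotopic.pmap (f : C(X, Y)) {x x' : X} {y y' : Y} (h : f x = y) (h' : f x' = y')
    {γ δ : Path x x'} (H : γ.Homotopic δ) : (Path.pmap f h h' γ).Homotopic (Path.pmap f h h' δ) := by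
  subst h h'; exact H.map f

lemma joined_iff_homotopic {x x' : X} {γ δ : Path x x'} : Joined γ δ ↔ γ.Homotopic δ := by
  constructor
  · rintro ⟨q⟩
    refine ⟨⟨⟨⟨fun z => q z.1 z.2, ?_⟩, fun t => ?_, fun t => ?_⟩, ?_⟩⟩
    · fun_prop
    · simp
    · simp
    · rintro t s (rfl | rfl)
      · simp
      · simp
  · rintro ⟨F⟩
    exact ⟨⟨⟨F.eval, Path.continuous_uncurry_iff.1 (map_continuous F)⟩, F.eval_zero, F.eval_one⟩⟩

lemma homotopic_iff_mk {x x' : X} {γ δ : Path x x'} :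
    γ.Homotopic δ ↔ Homotopic.Quotient.mk γ = Homotopic.Quotient.mk δ :=
  Homotopic.Quotient.eq.symm

lemma Homotopic.trans_symm_trans {a b c : X} (p : Path a b) (q : Path a c) :
    (p.trans (p.symm.trans q)).Homotopic q := by
  rw [homotopic_iff_mk]
  simp only [Homotopic.Quotient.mk_trans, Homotopic.Quotient.mk_symm,
    ← Homotopic.Quotient.trans_assoc, Homotopic.Quotient.trans_symm, Homotopic.Quotient.refl_trans]

lemma Homotopic.symm_trans_of {a b : X} {p q : Path a b} (h : p.Homotopic q) :
    (p.symm.trans q).Homotopic (Path.refl b) := by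
  rw [homotopic_iff_mk] at *
  simp only [Homotopic.Quotient.mk_trans, Homotopic.Quotient.mk_symm, h,
    Homotopic.Quotient.symm_trans, Homotopic.Quotient.mk_refl]

lemma Homotopic.of_trans_symm {a b : X} {p q : Path a b}
    (h : (p.trans q.symm).Homotopic (Path.refl a)) : p.Homotopic q := by
  rw [homotopic_iff_mk] at *
  simp only [Homotopic.Quotient.mk_trans, Homotopic.Quotient.mk_symm,
    Homotopic.Quotient.mk_refl] at h
  have := congrArg (fun z => Homotopic.Quotient.trans z (.mk q)) h
  simpa only [Homotopic.Quotient.trans_assoc, Homotopic.Quotient.symm_trans,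
    Homotopic.Quotient.trans_refl, Homotopic.Quotient.refl_trans] using this

lemma Homotopic.trans_symm_of {a b : X} {p q : Path a b} (h : p.Homotopic q) :
    (p.trans q.symm).Homotopic (Path.refl a) := by
  rw [homotopic_iff_mk] at *
  simp only [Homotopic.Quotient.mk_trans, Homotopic.Quotient.mk_symm, h,
    Homotopic.Quotient.trans_symm, Homotopic.Quotient.mk_refl]

end Path

/-! ### Relative surjectivity on homotopy -/

namespace HtpyLoc

open Path

variable {X Y Z : Type} [TopologicalSpace X] [TopologicalSpace Y] [TopologicalSpace Z]

/-- `f` hits every path component. -/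
def HitsComponents (f : C(X, Y)) : Prop := ∀ y, ∃ x, Joined (f x) y

/-- The vanishing of the relative homotopy of `f` in a single degree, expressed by iterated loop
spaces: in degree zero every path from a point of the image to `y₀` lifts up to homotopy to a path
ending in `x₀`. -/
def RelTrivial : ∀ (_ : ℕ) {X Y : Type} [TopologicalSpace X] [TopologicalSpace Y]
    (f : C(X, Y)) (x₀ : X) (y₀ : Y), f x₀ = y₀ → Prop
  | 0, X, _, _, _, f, x₀, y₀, h =>
    ∀ (x : X) (b : Path (f x) y₀), ∃ a : Path x x₀, (pmap f rfl h a).Homotopic b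
  | n + 1, _, _, _, _, f, x₀, y₀, h =>
    RelTrivial n (pmap f h h) (Path.refl x₀) (Path.refl y₀) (pmap_refl f h)

/-- Bijectivity on path components of the `n`-fold loop space. -/
def LoopBijective : ∀ (_ : ℕ) {X Y : Type} [TopologicalSpace X] [TopologicalSpace Y]
    (f : C(X, Y)) (x₀ : X) (y₀ : Y), f x₀ = y₀ → Prop
  | 0, _, _, _, _, f, _, _, _ => Function.Bijective (pi0Map f)
  | n + 1, _, _, _, _, f, x₀, y₀, h =>
    LoopBijective n (pmap f h h) (Path.refl x₀) (Path.refl y₀) (pmap_refl f h)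

lemma pi0Map_injective_iff (f : C(X, Y)) :
    Function.Injective (pi0Map f) ↔ ∀ x x', Joined (f x) (f x') → Joined x x' := by
  constructor
  · intro h x x' hj
    have : pi0Map f (Quotient.mk _ x) = pi0Map f (Quotient.mk _ x') := Quotient.sound hj
    exact Quotient.exact (h this)
  · intro h
    rintro ⟨x⟩ ⟨x'⟩ hx
    exact Quotient.sound (h x x' (Quotient.exact hx))

lemma pi0Map_surjective_iff (f : C(X, Y)) :
    Function.Surjective (pi0Map f) ↔ HitsComponents f := by
  constructor
  · intro h y
    obtain ⟨⟨x⟩, hx⟩ := h (Quotient.mk _ y)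
    exact ⟨x, Quotient.exact hx⟩
  · rintro h ⟨y⟩
    obtain ⟨x, hx⟩ := h y
    exact ⟨Quotient.mk _ x, Quotient.sound hx⟩

lemma relTrivial_of_loopBijective (n : ℕ) (f : C(X, Y)) (x₀ : X) (y₀ : Y) (h : f x₀ = y₀)
    (h₀ : LoopBijective n f x₀ y₀ h) (h₁ : LoopBijective (n + 1) f x₀ y₀ h) :
    RelTrivial n f x₀ y₀ h := by
  induction n generalizing X Y with
  | zero =>
    subst h
    intro x b
    have hi := (pi0Map_injective_iff f).1 h₀.1
    have hs := (pi0Map_surjective_iff _).1 h₁.2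
    obtain ⟨a⟩ := hi x x₀ ⟨b⟩
    obtain ⟨c, hc⟩ := hs ((pmap f rfl rfl a).symm.trans b)
    rw [joined_iff_homotopic] at hc
    refine ⟨a.trans c, ?_⟩
    rw [pmap_trans f rfl rfl rfl]
    exact ((Homotopic.refl _).hcomp hc).trans (Homotopic.trans_symm_trans _ _)
  | succ n ih => exact ih _ _ _ _ h₀ h₁

lemma loopBijective_succ_of_relTrivial (n : ℕ) (f : C(X, Y)) (x₀ : X) (y₀ : Y) (h : f x₀ = y₀)
    (h₀ : RelTrivial n f x₀ y₀ h) (h₁ : RelTrivial (n + 1) f x₀ y₀ h) :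
    LoopBijective (n + 1) f x₀ y₀ h := by
  induction n generalizing X Y with
  | zero =>
    subst h
    refine ⟨(pi0Map_injective_iff _).2 fun γ δ hγ => ?_, (pi0Map_surjective_iff _).2 fun b => ?_⟩
    · rw [joined_iff_homotopic] at hγ ⊢
      have : Joined (pmap f rfl rfl (γ.trans δ.symm)) (Path.refl (f x₀)) := by
        rw [joined_iff_homotopic, pmap_trans f rfl rfl rfl, pmap_symm f rfl rfl]
        exact Homotopic.trans_symm_of hγ
      obtain ⟨b⟩ := this
      obtain ⟨a, -⟩ := h₁ _ b
      exact Homotopic.of_trans_symm (joined_iff_homotopic.1 ⟨a⟩)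
    · obtain ⟨a, ha⟩ := h₀ x₀ b
      exact ⟨a, joined_iff_homotopic.2 ha⟩
  | succ n ih => exact ih _ _ _ _ h₀ h₁

/-! ### Homotopy groups as path components of iterated loop spaces -/

/-- Currying of generalized loops. -/
def curryLoop (n : ℕ) (x : X) (p : GenLoops (n + 1) X x) :
    GenLoops n (Path x x) (Path.refl x) :=
  ⟨⟨fun z => ⟨⟨fun t => p.1 (Fin.cons t z), by fun_prop⟩, p.2 _ ⟨0, Or.inl rfl⟩,
      p.2 _ ⟨0, Or.inr rfl⟩⟩,
    Path.continuous_uncurry_iff.1 (by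
      change Continuous fun q : (Fin n → I) × I => p.1 (Fin.cons q.2 q.1)
      fun_prop)⟩, by
    rintro y ⟨i, hi⟩
    ext t
    exact p.2 _ ⟨i.succ, by simpa using hi⟩⟩

/-- Uncurrying of generalized loops. -/
def uncurryLoop (n : ℕ) (x : X) (p : GenLoops n (Path x x) (Path.refl x)) :
    GenLoops (n + 1) X x :=
  ⟨⟨fun y => p.1 (Fin.tail y) (y 0), by
      have h := p.1.continuous
      have : Continuous fun y : Fin (n + 1) → I => Fin.tail y := by
        unfold Fin.tail; fun_prop
      exact (h.comp this).eval (continuous_apply 0)⟩, by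
    rintro y ⟨i, hi⟩
    change p.1 (Fin.tail y) (y 0) = x
    refine Fin.cases (fun hi => ?_) (fun j hi => ?_) i hi
    · rcases hi with hi | hi <;> simp [hi]
    · rw [p.2 _ ⟨j, hi⟩]; rfl⟩

lemma uncurry_curryLoop (n : ℕ) (x : X) (p : GenLoops (n + 1) X x) :
    uncurryLoop n x (curryLoop n x p) = p := by
  ext y
  exact congrArg p.1 (Fin.cons_self_tail y)

lemma curry_uncurryLoop (n : ℕ) (x : X) (p : GenLoops n (Path x x) (Path.refl x)) :
    curryLoop n x (uncurryLoop n x p) = p := by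
  ext y t
  rfl

lemma curryLoop_homotopic {n : ℕ} {x : X} {p q : GenLoops (n + 1) X x}
    (h : p.1.HomotopicRel q.1 (cubeBoundary (n + 1))) :
    (curryLoop n x p).1.HomotopicRel (curryLoop n x q).1 (cubeBoundary n) := by
  obtain ⟨F⟩ := h
  have hF : ∀ s, ∀ y ∈ cubeBoundary (n + 1), F (s, y) = x := fun s y hy =>
    (F.eq_fst s hy).trans (p.2 y hy)
  refine ⟨⟨⟨⟨fun z => ⟨⟨fun t => F (z.1, Fin.cons t z.2), by fun_prop⟩, hF _ _ ⟨0, Or.inl rfl⟩,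
      hF _ _ ⟨0, Or.inr rfl⟩⟩, Path.continuous_uncurry_iff.1 ?_⟩, fun z => ?_, fun z => ?_⟩, ?_⟩⟩
  · change Continuous fun q : (I × (Fin n → I)) × I => F (q.1.1, Fin.cons q.2 q.1.2)
    fun_prop
  · ext t; exact F.apply_zero _
  · ext t; exact F.apply_one _
  · rintro s y ⟨i, hi⟩
    ext t
    exact F.eq_fst s ⟨i.succ, by simpa using hi⟩

lemma uncurryLoop_homotopic {n : ℕ} {x : X} {p q : GenLoops n (Path x x) (Path.refl x)}
    (h : p.1.HomotopicRel q.1 (cubeBoundary n)) :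
    (uncurryLoop n x p).1.HomotopicRel (uncurryLoop n x q).1 (cubeBoundary (n + 1)) := by
  obtain ⟨F⟩ := h
  refine ⟨⟨⟨⟨fun z => F (z.1, Fin.tail z.2) (z.2 0), ?_⟩, fun z => ?_, fun z => ?_⟩, ?_⟩⟩
  · have : Continuous fun z : I × (Fin (n + 1) → I) => (z.1, Fin.tail z.2) := by
      unfold Fin.tail; fun_prop
    exact ((map_continuous F).comp this).eval (by fun_prop)
  · exact congrArg (fun γ : Path x x => γ (z 0)) (F.apply_zero _)
  · exact congrArg (fun γ : Path x x => γ (z 0)) (F.apply_one _)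
  · rintro s y ⟨i, hi⟩
    change F (s, Fin.tail y) (y 0) = p.1 (Fin.tail y) (y 0)
    refine Fin.cases (fun hi => ?_) (fun j hi => ?_) i hi
    · rcases hi with hi | hi <;> simp [hi]
    · exact congrArg (fun γ : Path x x => γ (y 0)) (F.eq_fst s ⟨j, hi⟩)

/-- The homotopy groups of the loop space. -/
def htpyGroupSucc (n : ℕ) (x : X) :
    HtpyGroup (n + 1) X x ≃ HtpyGroup n (Path x x) (Path.refl x) where
  toFun := Quotient.map (curryLoop n x) fun _ _ h => curryLoop_homotopic h
  invFun := Quotient.map (uncurryLoop n x) fun _ _ h => uncurryLoop_homotopic h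
  left_inv := by rintro ⟨p⟩; exact congrArg (Quotient.mk _) (uncurry_curryLoop n x p)
  right_inv := by rintro ⟨p⟩; exact congrArg (Quotient.mk _) (curry_uncurryLoop n x p)

lemma htpyGroupMap_succ_bijective_iff (n : ℕ) (f : C(X, Y)) (x : X) :
    Function.Bijective (htpyGroupMap (n + 1) f x) ↔
      Function.Bijective (htpyGroupMap n (pmap f (rfl : f x = f x) rfl) (Path.refl x)) := by
  have : (htpyGroupMap n (pmap f (rfl : f x = f x) rfl) (Path.refl x)) ∘ htpyGroupSucc n x =
      htpyGroupSucc n (f x) ∘ htpyGroupMap (n + 1) f x := by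
    funext p
    obtain ⟨p⟩ := p
    rfl
  rw [← (htpyGroupSucc n x).bijective.of_comp_iff, this]
  exact ((htpyGroupSucc n (f x)).bijective.of_comp_iff' _).symm

/-- The zeroth homotopy group is the set of path components. -/
def htpyGroupZero (x : X) : HtpyGroup 0 X x ≃ ZerothHomotopy X where
  toFun := Quotient.map (fun p => p.1 Fin.elim0) fun _ _ ⟨F⟩ =>
    ⟨⟨⟨fun t => F (t, Fin.elim0), by fun_prop⟩, F.apply_zero _, F.apply_one _⟩⟩
  invFun := Quotient.map (fun z => ⟨ContinuousMap.const _ z, by rintro y ⟨i, -⟩; exact i.elim0⟩)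
    fun a b ⟨γ⟩ => ⟨⟨⟨⟨fun z => γ z.1, by fun_prop⟩, fun z => γ.source, fun z => γ.target⟩, by
      rintro s y ⟨i, -⟩; exact i.elim0⟩⟩
  left_inv := by
    rintro ⟨p⟩
    refine congrArg (Quotient.mk _) ?_
    ext y
    exact congrArg p.1 (Subsingleton.elim _ _)
  right_inv := by rintro ⟨p⟩; rfl

lemma htpyGroupMap_zero_bijective_iff (f : C(X, Y)) (x : X) :
    Function.Bijective (htpyGroupMap 0 f x) ↔ Function.Bijective (pi0Map f) := by
  have : pi0Map f ∘ htpyGroupZero x = htpyGroupZero (f x) ∘ htpyGroupMap 0 f x := by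
    funext p
    obtain ⟨p⟩ := p
    rfl
  rw [← (htpyGroupZero x).bijective.of_comp_iff, this,
    (htpyGroupZero (f x)).bijective.of_comp_iff']

lemma htpyGroupMap_bijective_iff (n : ℕ) (f : C(X, Y)) (x : X) :
    Function.Bijective (htpyGroupMap n f x) ↔ LoopBijective n f x (f x) rfl := by
  induction n generalizing X Y with
  | zero => exact htpyGroupMap_zero_bijective_iff f x
  | succ n ih =>
    rw [htpyGroupMap_succ_bijective_iff, ih]
    have key : ∀ (y : Path (f x) (f x)) (h : pmap f (rfl : f x = f x) rfl (Path.refl x) = y),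
        LoopBijective n (pmap f (rfl : f x = f x) rfl) (Path.refl x) _ rfl ↔
        LoopBijective n (pmap f (rfl : f x = f x) rfl) (Path.refl x) y h := by
      rintro y rfl; rfl
    exact key _ _

lemma isWeakHomotopyEquiv_iff_loopBijective (f : C(X, Y)) :
    IsWeakHomotopyEquiv f ↔ Function.Bijective (pi0Map f) ∧
      ∀ n x y (h : f x = y), LoopBijective n f x y h := by
  refine and_congr_right fun h0 => ?_
  constructor
  · rintro h n x y rfl
    cases n with
    | zero => exact h0
    | succ n => exact (htpyGroupMap_bijective_iff _ f x).1 (h n x)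
  · intro h n x
    exact (htpyGroupMap_bijective_iff _ f x).2 (h _ _ _ _)

/-- Weak homotopy equivalences in terms of relative homotopy. -/
lemma isWeakHomotopyEquiv_iff (f : C(X, Y)) :
    IsWeakHomotopyEquiv f ↔ HitsComponents f ∧ ∀ n x y (h : f x = y), RelTrivial n f x y h := by
  rw [isWeakHomotopyEquiv_iff_loopBijective]
  constructor
  · rintro ⟨h, h'⟩
    exact ⟨(pi0Map_surjective_iff f).1 h.2, fun n x y hx =>
      relTrivial_of_loopBijective n f x y hx (h' _ _ _ _) (h' _ _ _ _)⟩
  · rintro ⟨h, h'⟩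
    have h0 : Function.Bijective (pi0Map f) :=
      ⟨(pi0Map_injective_iff f).2 fun x x' ⟨b⟩ => ⟨(h' 0 x' _ rfl x b).choose⟩,
        (pi0Map_surjective_iff f).2 h⟩
    refine ⟨h0, fun n x y hx => ?_⟩
    cases n with
    | zero => exact h0
    | succ n => exact loopBijective_succ_of_relTrivial n f x y hx (h' _ _ _ _) (h' _ _ _ _)

lemma loopBijective_of_square {X' Y' : Type} [TopologicalSpace X'] [TopologicalSpace Y'] (n : ℕ)
    (g : C(X, Y)) (g' : C(X', Y')) (q : C(X, X')) (q' : C(Y, Y')) (H : ∀ x, q' (g x) = g' (q x))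
    {x : X} {x' : X'} {y : Y} {y' : Y'} (hg : g x = y) (hg' : g' x' = y') (hq : q x = x')
    (hq' : q' y = y') (h₁ : LoopBijective n q x x' hq) (h₂ : LoopBijective n q' y y' hq')
    (h₃ : LoopBijective n g' x' y' hg') : LoopBijective n g x y hg := by
  induction n generalizing X Y X' Y' with
  | zero =>
    have : pi0Map q' ∘ pi0Map g = pi0Map g' ∘ pi0Map q := by
      funext z
      obtain ⟨z⟩ := z
      exact congrArg (Quotient.mk _) (H z)
    change Function.Bijective _ at h₁ h₂ h₃ ⊢
    rw [← h₂.of_comp_iff', this]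
    exact h₃.comp h₁
  | succ n ih =>
    exact ih (pmap g hg hg) (pmap g' hg' hg') (pmap q hq hq) (pmap q' hq' hq')
      (fun γ => by ext t; exact H _) _ _ _ _ h₁ h₂ h₃

/-- A square with three weak homotopy equivalences. -/
lemma IsWeakHomotopyEquiv.of_square {X' Y' : Type} [TopologicalSpace X'] [TopologicalSpace Y']
    (g : C(X, Y)) (g' : C(X', Y')) (q : C(X, X')) (q' : C(Y, Y')) (H : ∀ x, q' (g x) = g' (q x))
    (h₁ : IsWeakHomotopyEquiv q) (h₂ : IsWeakHomotopyEquiv q') (h₃ : IsWeakHomotopyEquiv g') :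
    IsWeakHomotopyEquiv g := by
  rw [isWeakHomotopyEquiv_iff_loopBijective] at *
  refine ⟨?_, fun n x y h => ?_⟩
  · have : pi0Map q' ∘ pi0Map g = pi0Map g' ∘ pi0Map q := by
      funext z
      obtain ⟨z⟩ := z
      exact congrArg (Quotient.mk _) (H z)
    rw [← h₂.1.of_comp_iff', this]
    exact h₃.1.comp h₁.1
  · subst h
    exact loopBijective_of_square n g g' q q' H rfl rfl rfl (H x) (h₁.2 _ _ _ _) (h₂.2 _ _ _ _)
      (h₃.2 _ _ _ _)

end HtpyLoc

/-! ### Lifting properties against cubes -/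

namespace HtpyLoc

open Path

variable {E B : Type} [TopologicalSpace E] [TopologicalSpace B]

/-- The lifting property of `p` against the inclusion of a subset of a cube. -/
def LiftsAgainst {k : ℕ} (Z : Set (Fin k → I)) (p : C(E, B)) : Prop :=
  ∀ (h : (Fin k → I) → E) (g : C((Fin k → I), B)), ContinuousOn h Z → (∀ y ∈ Z, p (h y) = g y) →
    ∃ G : C((Fin k → I), E), (∀ y ∈ Z, G y = h y) ∧ ∀ y, p (G y) = g y

/-- The open box: the union of all faces of the cube but one. -/
def openBox (n : ℕ) : Set (Fin (n + 1) → I) :=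
  {y | y 0 = 0 ∨ ∃ j : Fin n, y j.succ = 0 ∨ y j.succ = 1}

/-- Serre fibrations, as lifting property against the open boxes. -/
def IsFib (p : C(E, B)) : Prop := ∀ n, LiftsAgainst (openBox n) p

/-- Acyclic fibrations, as surjective maps with the lifting property against the boundaries of cubes. -/
def IsAcyclicFib (p : C(E, B)) : Prop :=
  Function.Surjective p ∧ ∀ n, LiftsAgainst (cubeBoundary n) p

/-- The union of the cylinder over a subset of a cube with the two ends of the cylinder. -/
def cylinderBoundary {k : ℕ} (Z : Set (Fin k → I)) : Set (Fin (k + 1) → I) :=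
  {y | Fin.init y ∈ Z ∨ y (Fin.last k) = 0 ∨ y (Fin.last k) = 1}

lemma continuous_init {k : ℕ} : Continuous (Fin.init : (Fin (k + 1) → I) → Fin k → I) := by
  unfold Fin.init; fun_prop

lemma LiftsAgainst.pmap {k : ℕ} {Z : Set (Fin k → I)} (hZ : IsClosed Z) {p : C(E, B)}
    (hp : LiftsAgainst (cylinderBoundary Z) p) {e e' : E} {b b' : B} (hb : p e = b)
    (hb' : p e' = b') : LiftsAgainst Z (Path.pmap p hb hb') := by
  classical
  intro h g hh hg
  let h' : (Fin (k + 1) → I) → E := fun y => if Fin.init y ∈ Z then h (Fin.init y) (y (Fin.last k))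
    else if y (Fin.last k) = 0 then e else e'
  have h0 : ∀ y, y (Fin.last k) = 0 → h' y = e := by
    intro y hy
    by_cases hz : Fin.init y ∈ Z <;> simp [h', hy, hz]
  have h1 : ∀ y, y (Fin.last k) = 1 → h' y = e' := by
    intro y hy
    by_cases hz : Fin.init y ∈ Z <;> simp [h', hy, hz]
  have hz : ∀ y : Fin (k + 1) → I, (Fin.init y : Fin k → I) ∈ Z →
      h' y = h (Fin.init y) (y (Fin.last k)) := by
    intro y hy; simp [h', hy]
  have c0 : IsClosed {y : Fin (k + 1) → I | y (Fin.last k) = 0} :=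
    isClosed_eq (continuous_apply _) continuous_const
  have c1 : IsClosed {y : Fin (k + 1) → I | y (Fin.last k) = 1} :=
    isClosed_eq (continuous_apply _) continuous_const
  have cont : ContinuousOn h' (cylinderBoundary Z) := by
    refine ContinuousOn.union_of_isClosed ?_ (ContinuousOn.union_of_isClosed ?_ ?_ c0 c1)
      (hZ.preimage continuous_init) (c0.union c1)
    · refine ContinuousOn.congr ?_ hz
      exact (hh.comp continuous_init.continuousOn fun y hy => hy).eval
        (continuous_apply _).continuousOn
    · exact continuousOn_const.congr (f := fun _ => e) h0
    · exact continuousOn_const.congr (f := fun _ => e') h1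
  have cg : Continuous fun y : Fin (k + 1) → I => g (Fin.init y) (y (Fin.last k)) :=
    (g.continuous.comp continuous_init).eval (continuous_apply _)
  obtain ⟨G, hG, hpG⟩ := hp h' ⟨_, cg⟩ cont (by
    rintro y (hy | hy | hy)
    · rw [hz y hy]; exact congrArg (fun γ : Path b b' => γ (y (Fin.last k))) (hg _ hy)
    · rw [h0 y hy, hb]; simp [hy]
    · rw [h1 y hy, hb']; simp [hy])
  refine ⟨⟨fun z => ⟨⟨fun t => G (Fin.snoc z t), ?_⟩, ?_, ?_⟩, Path.continuous_uncurry_iff.1 ?_⟩,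
    fun z hzZ => ?_, fun z => ?_⟩
  · exact G.continuous.comp (Continuous.finSnoc continuous_const continuous_id)
  · exact (hG _ (Or.inr (Or.inl (by simp)))).trans (h0 _ (by simp))
  · exact (hG _ (Or.inr (Or.inr (by simp)))).trans (h1 _ (by simp))
  · exact G.continuous.comp (Continuous.finSnoc continuous_fst continuous_snd)
  · ext t
    change G (Fin.snoc z t) = _
    rw [hG _ (Or.inl (by simpa using hzZ)), hz _ (by simpa using hzZ)]
    simp
  · ext t
    change p (G (Fin.snoc z t)) = _
    rw [hpG]
    simp

lemma isClosed_cubeBoundary (n : ℕ) : IsClosed (cubeBoundary n) := by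
  have : cubeBoundary n = ⋃ i : Fin n, {y | y i = 0 ∨ y i = 1} := by
    ext y; simp [cubeBoundary]
  rw [this]
  exact isClosed_iUnion_of_finite fun i =>
    (isClosed_eq (continuous_apply i) continuous_const).union
      (isClosed_eq (continuous_apply i) continuous_const)

lemma isClosed_openBox (n : ℕ) : IsClosed (openBox n) := by
  have : openBox n = {y | y 0 = 0} ∪ ⋃ j : Fin n, {y | y j.succ = 0 ∨ y j.succ = 1} := by
    ext y; simp [openBox]
  rw [this]
  exact (isClosed_eq (continuous_apply _) continuous_const).union
    (isClosed_iUnion_of_finite fun i =>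
      (isClosed_eq (continuous_apply _) continuous_const).union
        (isClosed_eq (continuous_apply _) continuous_const))

lemma cylinderBoundary_cubeBoundary (n : ℕ) :
    cylinderBoundary (cubeBoundary n) = cubeBoundary (n + 1) := by
  ext y
  simp [cylinderBoundary, cubeBoundary, Fin.exists_fin_succ', Fin.init]

lemma cylinderBoundary_openBox (n : ℕ) : cylinderBoundary (openBox n) = openBox (n + 1) := by
  ext y
  simp [cylinderBoundary, openBox, Fin.exists_fin_succ', Fin.init, or_assoc]

lemma IsFib.pmap {p : C(E, B)} (hp : IsFib p) {e e' : E} {b b' : B} (hb : p e = b)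
    (hb' : p e' = b') : IsFib (Path.pmap p hb hb') := fun n =>
  LiftsAgainst.pmap (isClosed_openBox n) (cylinderBoundary_openBox n ▸ hp (n + 1)) hb hb'

lemma IsFib.exists_path_lift {p : C(E, B)} (hp : IsFib p) {e : E} {b b' : B} (hb : p e = b)
    (c : Path b b') : ∃ (e' : E) (hb' : p e' = b') (γ : Path e e'), Path.pmap p hb hb' γ = c := by
  obtain ⟨G, hG, hpG⟩ := hp 0 (fun _ => e) ⟨fun y => c (y 0), by fun_prop⟩ continuousOn_const (by
    rintro y (hy | ⟨j, -⟩)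
    · simp [hy, hb]
    · exact j.elim0)
  refine ⟨G fun _ => 1, (hpG _).trans c.target, ⟨⟨fun t => G fun _ => t, by fun_prop⟩,
    hG _ (Or.inl rfl), rfl⟩, ?_⟩
  ext t
  exact hpG _

lemma IsFib.exists_homotopic_lift {p : C(E, B)} (hp : IsFib p) {e e' : E} {b b' : B}
    (hb : p e = b) (hb' : p e' = b') (γ : Path e e') {δ : Path b b'}
    (H : (Path.pmap p hb hb' γ).Homotopic δ) :
    ∃ γ' : Path e e', γ'.Homotopic γ ∧ Path.pmap p hb hb' γ' = δ := by
  obtain ⟨q⟩ := joined_iff_homotopic.2 H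
  obtain ⟨γ', h, r, hr⟩ := (hp.pmap hb hb').exists_path_lift rfl q
  exact ⟨γ', (joined_iff_homotopic.1 ⟨r⟩).symm, h⟩

lemma IsAcyclicFib.exists_path_lift {p : C(E, B)} (hp : IsAcyclicFib p) {e e' : E} {b b' : B}
    (hb : p e = b) (hb' : p e' = b') (c : Path b b') : ∃ γ : Path e e', Path.pmap p hb hb' γ = c := by
  classical
  obtain ⟨G, hG, hpG⟩ := hp.2 1 (fun y => if y 0 = 0 then e else e')
    ⟨fun y => c (y 0), by fun_prop⟩
    (by
      have : cubeBoundary 1 = {y | y 0 = 0} ∪ {y | y 0 = 1} := by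
        ext y; simp [cubeBoundary]
      rw [this]
      refine ContinuousOn.union_of_isClosed ?_ ?_
        (isClosed_eq (continuous_apply _) continuous_const)
        (isClosed_eq (continuous_apply _) continuous_const)
      · exact continuousOn_const.congr (f := fun _ => e) fun y (hy : y 0 = 0) => by simp [hy]
      · exact continuousOn_const.congr (f := fun _ => e') fun y (hy : y 0 = 1) => by simp [hy])
    (by
      rintro y ⟨i, hi⟩
      rw [Subsingleton.elim i 0] at hi
      rcases hi with hi | hi <;> simp [hi, hb, hb'])
  refine ⟨⟨⟨fun t => G fun _ => t, by fun_prop⟩, ?_, ?_⟩, ?_⟩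
  · exact (hG _ ⟨0, Or.inl rfl⟩).trans (by simp)
  · exact (hG (fun _ => 1) ⟨0, Or.inr rfl⟩).trans (by simp)
  · ext t
    exact hpG _

lemma IsAcyclicFib.pmap {p : C(E, B)} (hp : IsAcyclicFib p) {e e' : E} {b b' : B} (hb : p e = b)
    (hb' : p e' = b') : IsAcyclicFib (Path.pmap p hb hb') :=
  ⟨hp.exists_path_lift hb hb', fun n => LiftsAgainst.pmap (isClosed_cubeBoundary n)
    (cylinderBoundary_cubeBoundary n ▸ hp.2 (n + 1)) hb hb'⟩

lemma IsAcyclicFib.relTrivial {p : C(E, B)} (hp : IsAcyclicFib p) (n : ℕ) (e : E) (b : B)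
    (hb : p e = b) : RelTrivial n p e b hb := by
  induction n generalizing E B with
  | zero =>
    intro x c
    obtain ⟨a, ha⟩ := hp.exists_path_lift rfl hb c
    exact ⟨a, ha ▸ Homotopic.refl _⟩
  | succ n ih => exact ih (hp.pmap hb hb) _ _ _

lemma IsAcyclicFib.isWeakHomotopyEquiv {p : C(E, B)} (hp : IsAcyclicFib p) :
    IsWeakHomotopyEquiv p := by
  refine (isWeakHomotopyEquiv_iff p).2 ⟨fun b => ?_, fun n x y h => hp.relTrivial n x y h⟩
  obtain ⟨e, rfl⟩ := hp.1 b
  exact ⟨e, Joined.refl _⟩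

lemma isWeakHomotopyEquiv_of_homeomorph (e : E ≃ₜ B) : IsWeakHomotopyEquiv (e : C(E, B)) :=
  IsAcyclicFib.isWeakHomotopyEquiv ⟨e.surjective, fun _ h g _ hg =>
    ⟨⟨fun y => e.symm (g y), by fun_prop⟩, fun y hy => by simp [← hg y hy], fun y => by simp⟩⟩

/-- Invariance of weak homotopy equivalences under homeomorphisms. -/
lemma isWeakHomotopyEquiv_congr {E' B' : Type} [TopologicalSpace E'] [TopologicalSpace B']
    (f : C(E, B)) (f' : C(E', B')) (e : E ≃ₜ E') (b : B ≃ₜ B') (H : ∀ x, b (f x) = f' (e x)) :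
    IsWeakHomotopyEquiv f ↔ IsWeakHomotopyEquiv f' :=
  ⟨fun h => IsWeakHomotopyEquiv.of_square f' f (e.symm : C(E', E)) (b.symm : C(B', B))
      (fun x => by
        have := H (e.symm x)
        rw [e.apply_symm_apply] at this
        exact b.symm_apply_eq.2 this.symm)
      (isWeakHomotopyEquiv_of_homeomorph _) (isWeakHomotopyEquiv_of_homeomorph _) h,
    fun h => IsWeakHomotopyEquiv.of_square f f' (e : C(E, E')) (b : C(B, B')) H
      (isWeakHomotopyEquiv_of_homeomorph _) (isWeakHomotopyEquiv_of_homeomorph _) h⟩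

end HtpyLoc

/-! ### Comparison of fibration sequences -/

namespace HtpyLoc

open Path Topology

variable {A E B A' E' B' : Type} [TopologicalSpace A] [TopologicalSpace E] [TopologicalSpace B]
  [TopologicalSpace A'] [TopologicalSpace E'] [TopologicalSpace B']

/-- `i` is, up to homeomorphism, the inclusion of the fiber of `p` over `b₀`. -/
structure IsFiberInclusion (i : C(A, E)) (p : C(E, B)) (b₀ : B) : Prop where
  isEmbedding : IsEmbedding i
  range : ∀ e, p e = b₀ ↔ ∃ a, i a = e

lemma IsFiberInclusion.exists_path {i : C(A, E)} {p : C(E, B)} {b₀ : B}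
    (hi : IsFiberInclusion i p b₀) {a a' : A} {e e' : E} (h : i a = e) (h' : i a' = e')
    (β : Path e e') (hβ : ∀ t, p (β t) = b₀) : ∃ β' : Path a a', pmap i h h' β' = β := by
  choose γ hγ using fun t => (hi.range _).1 (hβ t)
  have hγ' : i ∘ γ = β := funext hγ
  refine ⟨⟨⟨γ, ?_⟩, ?_, ?_⟩, ?_⟩
  · rw [hi.isEmbedding.continuous_iff, hγ']; exact β.continuous
  · exact hi.isEmbedding.injective (by rw [hγ, h]; exact β.source)
  · exact hi.isEmbedding.injective (by rw [hγ, h']; exact β.target)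
  · ext t; exact hγ t

lemma IsFiberInclusion.pmap {i : C(A, E)} {p : C(E, B)} {b₀ : B}
    (hi : IsFiberInclusion i p b₀) {a a' : A} {e e' : E} (h : i a = e) (h' : i a' = e')
    (hp : p e = b₀) (hp' : p e' = b₀) :
    IsFiberInclusion (Path.pmap i h h') (Path.pmap p hp hp') (Path.refl b₀) where
  isEmbedding := by
    refine ⟨?_, fun γ δ hγ => ?_⟩
    · have h1 : IsInducing ((↑) : Path e e' → C(I, E)) := ⟨rfl⟩
      have h2 : IsInducing ((↑) : Path a a' → C(I, A)) := ⟨rfl⟩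
      rw [← h1.of_comp_iff]
      exact (ContinuousMap.isInducing_postcomp i hi.isEmbedding.isInducing).comp h2
    · ext t
      exact hi.isEmbedding.injective (congrArg (fun γ : Path e e' => γ t) hγ)
  range β := by
    constructor
    · intro hβ
      exact hi.exists_path h h' β fun t => congrArg (fun γ : Path b₀ b₀ => γ t) hβ
    · rintro ⟨β', rfl⟩
      ext t
      exact (hi.range _).2 ⟨β' t, rfl⟩

lemma IsFiberInclusion.exists_homotopic {i : C(A, E)} {p : C(E, B)} {b₀ : B}
    (hi : IsFiberInclusion i p b₀) (hp : IsFib p) {a a' : A} {e e' : E} (h : i a = e)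
    (h' : i a' = e') (hb : p e = b₀) (hb' : p e' = b₀) (d : Path e e')
    (hd : (Path.pmap p hb hb' d).Homotopic (Path.refl b₀)) :
    ∃ d' : Path a a', (Path.pmap i h h' d').Homotopic d := by
  obtain ⟨d₁, h₁, hd₁⟩ := hp.exists_homotopic_lift hb hb' d hd
  obtain ⟨d', rfl⟩ := hi.exists_path h h' d₁ fun t => congrArg (fun γ : Path b₀ b₀ => γ t) hd₁
  exact ⟨d', h₁⟩

lemma IsFiberInclusion.exists_transport {i : C(A, E)} {p : C(E, B)} {p' : C(E', B')}
    {F : C(E, E')} {f : C(B, B')} (hF : ∀ e, p' (F e) = f (p e)) {b₀ : B} {b₀' : B'}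
    (hi : IsFiberInclusion i p b₀) (hp : IsFib p) (hfb : f b₀ = b₀')
    (h : RelTrivial 0 f b₀ b₀' hfb) (e : E) {e₀' : E'} (he : p' e₀' = b₀') (β : Path (F e) e₀') :
    ∃ (a : A) (c : Path e (i a)) (d : Path (F (i a)) e₀') (hd : p' (F (i a)) = b₀'),
      (Path.pmap p' hd he d).Homotopic (Path.refl b₀') ∧
      ((Path.pmap F rfl rfl c).trans d).Homotopic β := by
  obtain ⟨c, hc⟩ := h (p e) (Path.pmap p' (hF e) he β)
  obtain ⟨e₁, he₁, c₁, hc₁⟩ := hp.exists_path_lift rfl c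
  obtain ⟨a, rfl⟩ := (hi.range e₁).1 he₁
  have hd : p' (F (i a)) = b₀' := by rw [hF, he₁, hfb]
  refine ⟨a, c₁, (Path.pmap F rfl rfl c₁).symm.trans β, hd, ?_, Homotopic.trans_symm_trans _ _⟩
  rw [pmap_trans p' hd (hF e) he, pmap_symm p' (hF e) hd]
  refine Homotopic.symm_trans_of ?_
  convert hc using 1
  ext t
  change p' (F (c₁ t)) = f (c t)
  rw [hF, ← hc₁]
  rfl

lemma exists_joined_fiber {i : C(A, E)} {p : C(E, B)} {i' : C(A', E')} {p' : C(E', B')}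
    {G : C(A, A')} {F : C(E, E')} {f : C(B, B')} (hG : ∀ a, i' (G a) = F (i a))
    (hF : ∀ e, p' (F e) = f (p e)) {b₀ : B} {b₀' : B'} (hi : IsFiberInclusion i p b₀)
    (hi' : IsFiberInclusion i' p' b₀') (hp : IsFib p) (hp' : IsFib p') (hfb : f b₀ = b₀')
    (h : RelTrivial 0 f b₀ b₀' hfb) (e : E) (a' : A') (β : Path (F e) (i' a')) :
    ∃ a, Joined (G a) a' := by
  obtain ⟨a, c, d, hd, hpd, -⟩ := hi.exists_transport hF hp hfb h e ((hi'.range _).2 ⟨a', rfl⟩) β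
  obtain ⟨d', -⟩ := hi'.exists_homotopic hp' (hG a) rfl hd ((hi'.range _).2 ⟨a', rfl⟩) d hpd
  exact ⟨a, ⟨d'⟩⟩

/-- Relative triviality on the total space from base and fiber. -/
lemma relTrivial_total (n : ℕ) {i : C(A, E)} {p : C(E, B)} {i' : C(A', E')} {p' : C(E', B')}
    {G : C(A, A')} {F : C(E, E')} {f : C(B, B')} (hG : ∀ a, i' (G a) = F (i a))
    (hF : ∀ e, p' (F e) = f (p e)) {a₀ : A} {e₀ : E} {b₀ : B} {a₀' : A'} {e₀' : E'} {b₀' : B'}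
    (hi : IsFiberInclusion i p b₀) (hi' : IsFiberInclusion i' p' b₀') (hp : IsFib p)
    (hp' : IsFib p') (hae : i a₀ = e₀) (heb : p e₀ = b₀) (hae' : i' a₀' = e₀') (heb' : p' e₀' = b₀')
    (hGa : G a₀ = a₀') (hFe : F e₀ = e₀') (hfb : f b₀ = b₀')
    (h : RelTrivial n G a₀ a₀' hGa) (h' : RelTrivial n f b₀ b₀' hfb) :
    RelTrivial n F e₀ e₀' hFe := by
  induction n generalizing A E B A' E' B' with
  | zero =>
    intro e b
    obtain ⟨a, c, d, hd, hpd, hcd⟩ := hi.exists_transport hF hp hfb h' e heb' b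
    obtain ⟨d', hd'⟩ := hi'.exists_homotopic hp' (hG a) hae' hd heb' d hpd
    obtain ⟨k, hk⟩ := h a d'
    refine ⟨c.trans (pmap i rfl hae k), ?_⟩
    rw [pmap_trans F rfl rfl hFe]
    refine Homotopic.trans ((Homotopic.refl _).hcomp ?_) hcd
    refine Homotopic.trans ?_ hd'
    convert hk.pmap i' (hG a) hae' using 1
    ext t
    exact (hG _).symm
  | succ n ih =>
    exact ih (i := pmap i hae hae) (p := pmap p heb heb) (i' := pmap i' hae' hae')
      (p' := pmap p' heb' heb') (fun γ => by ext t; exact hG _) (fun γ => by ext t; exact hF _)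
      (hi.pmap _ _ _ _) (hi'.pmap _ _ _ _) (hp.pmap _ _) (hp'.pmap _ _) (pmap_refl _ _)
      (pmap_refl _ _) (pmap_refl _ _) (pmap_refl _ _) _ _ _ h h'

/-- Relative triviality on the fiber from base and total space. -/
lemma relTrivial_fiber (n : ℕ) {i : C(A, E)} {p : C(E, B)} {i' : C(A', E')} {p' : C(E', B')}
    {G : C(A, A')} {F : C(E, E')} {f : C(B, B')} (hG : ∀ a, i' (G a) = F (i a))
    (hF : ∀ e, p' (F e) = f (p e)) {a₀ : A} {e₀ : E} {b₀ : B} {a₀' : A'} {e₀' : E'} {b₀' : B'}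
    (hi : IsFiberInclusion i p b₀) (hi' : IsFiberInclusion i' p' b₀') (hp : IsFib p)
    (hp' : IsFib p') (hae : i a₀ = e₀) (heb : p e₀ = b₀) (hae' : i' a₀' = e₀') (heb' : p' e₀' = b₀')
    (hGa : G a₀ = a₀') (hFe : F e₀ = e₀') (hfb : f b₀ = b₀')
    (h : RelTrivial n F e₀ e₀' hFe) (h' : RelTrivial (n + 1) f b₀ b₀' hfb) :
    RelTrivial n G a₀ a₀' hGa := by
  induction n generalizing A E B A' E' B' with
  | zero =>
    intro a b
    obtain ⟨c, hc⟩ := h (i a) (pmap i' (hG a) hae' b)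
    obtain ⟨H⟩ := joined_iff_homotopic.2 hc
    have ha : p (i a) = b₀ := (hi.range _).2 ⟨a, rfl⟩
    have ha' : p' (F (i a)) = b₀' := by rw [hF, ha, hfb]
    obtain ⟨k, hk⟩ := exists_joined_fiber (i := pmap i rfl hae) (p := pmap p ha heb)
      (i' := pmap i' (hG a) hae') (p' := pmap p' ha' heb') (G := pmap G rfl hGa)
      (F := pmap F rfl hFe) (f := pmap f hfb hfb) (fun γ => by ext t; exact hG _)
      (fun γ => by ext t; exact hF _) (hi.pmap _ _ _ _) (hi'.pmap _ _ _ _) (hp.pmap _ _)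
      (hp'.pmap _ _) (pmap_refl _ _) h' c b H
    exact ⟨k, joined_iff_homotopic.1 hk⟩
  | succ n ih =>
    exact ih (i := pmap i hae hae) (p := pmap p heb heb) (i' := pmap i' hae' hae')
      (p' := pmap p' heb' heb') (fun γ => by ext t; exact hG _) (fun γ => by ext t; exact hF _)
      (hi.pmap _ _ _ _) (hi'.pmap _ _ _ _) (hp.pmap _ _) (hp'.pmap _ _) (pmap_refl _ _)
      (pmap_refl _ _) (pmap_refl _ _) (pmap_refl _ _) _ _ _ h h'

/-- The map induced on fibers. -/
def fiberMap {p : C(E, B)} {p' : C(E', B')} {F : C(E, E')} {f : C(B, B')}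
    (hF : ∀ e, p' (F e) = f (p e)) (b : B) : C({e // p e = b}, {e' // p' e' = f b}) :=
  ⟨fun e => ⟨F e.1, by rw [hF, e.2]⟩, by fun_prop⟩

/-- The inclusion of a fiber. -/
def fiberVal (p : C(E, B)) (b : B) : C({e // p e = b}, E) :=
  ⟨Subtype.val, continuous_subtype_val⟩

lemma isFiberInclusion_val (p : C(E, B)) (b : B) : IsFiberInclusion (fiberVal p b) p b :=
  ⟨IsEmbedding.subtypeVal, fun e => ⟨fun h => ⟨⟨e, h⟩, rfl⟩, by rintro ⟨a, rfl⟩; exact a.2⟩⟩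

/-- A map of fibrations which is a weak equivalence on bases and total spaces is one on fibers. -/
lemma isWeakHomotopyEquiv_fiberMap {p : C(E, B)} {p' : C(E', B')} {F : C(E, E')} {f : C(B, B')}
    (hF : ∀ e, p' (F e) = f (p e)) (hp : IsFib p) (hp' : IsFib p') (h : IsWeakHomotopyEquiv F)
    (h' : IsWeakHomotopyEquiv f) (b : B) : IsWeakHomotopyEquiv (fiberMap hF b) := by
  rw [isWeakHomotopyEquiv_iff] at *
  refine ⟨fun e' => ?_, fun n e e' he => ?_⟩
  · obtain ⟨e, ⟨β⟩⟩ := h.1 e'.1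
    exact exists_joined_fiber (i := fiberVal p b) (i' := fiberVal p' (f b))
      (G := fiberMap hF b) (fun _ => rfl) hF (isFiberInclusion_val p b)
      (isFiberInclusion_val p' (f b)) hp hp' rfl (h'.2 0 b _ rfl) e e' β
  · exact relTrivial_fiber n (i := fiberVal p b) (i' := fiberVal p' (f b))
      (G := fiberMap hF b) (fun _ => rfl) hF (isFiberInclusion_val p b)
      (isFiberInclusion_val p' (f b)) hp hp' rfl e.2 rfl e'.2 he (congrArg Subtype.val he) rfl
      (h.2 _ _ _ _) (h'.2 _ _ _ _)

/-- A map of fibrations which is a weak equivalence on bases and fibers is one on total spaces. -/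
lemma isWeakHomotopyEquiv_of_fiberMap {p : C(E, B)} {p' : C(E', B')} {F : C(E, E')} {f : C(B, B')}
    (hF : ∀ e, p' (F e) = f (p e)) (hp : IsFib p) (hp' : IsFib p')
    (h : ∀ b, IsWeakHomotopyEquiv (fiberMap hF b)) (h' : IsWeakHomotopyEquiv f) :
    IsWeakHomotopyEquiv F := by
  rw [isWeakHomotopyEquiv_iff] at *
  simp only [isWeakHomotopyEquiv_iff] at h
  refine ⟨fun e' => ?_, fun n e e' he => ?_⟩
  · obtain ⟨b, ⟨β⟩⟩ := h'.1 (p' e')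
    obtain ⟨e₁, he₁, c, -⟩ := hp'.exists_path_lift rfl β.symm
    obtain ⟨a, ⟨γ⟩⟩ := (h b).1 ⟨e₁, he₁⟩
    exact ⟨a.1, Joined.trans ⟨γ.map continuous_subtype_val⟩ ⟨c.symm⟩⟩
  · subst he
    exact relTrivial_total n (i := fiberVal p (p e)) (i' := fiberVal p' (f (p e)))
      (G := fiberMap hF (p e)) (fun _ => rfl) hF
      (isFiberInclusion_val p (p e)) (isFiberInclusion_val p' (f (p e))) hp hp'
      (a₀ := ⟨e, rfl⟩) (a₀' := ⟨F e, hF e⟩) rfl rfl rfl (hF e) rfl rfl rfl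
      ((h (p e)).2 _ _ _ _) (h'.2 _ _ _ _)

end HtpyLoc

/-! ### Extending stratified maps over simplices -/

lemma maxSupp_pos {n : ℕ} (x : stdSimplex ℝ (Fin (n + 1))) : 0 < x.1 (maxSupp x) :=
  (Finset.mem_filter.1 (Finset.max'_mem (Finset.univ.filter fun i => 0 < x.1 i) _)).2

lemma le_maxSupp {n : ℕ} (x : stdSimplex ℝ (Fin (n + 1))) {i : Fin (n + 1)} (h : 0 < x.1 i) :
    i ≤ maxSupp x :=
  Finset.le_max' _ _ (Finset.mem_filter.2 ⟨Finset.mem_univ i, h⟩)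

lemma maxSupp_eq {n : ℕ} (x : stdSimplex ℝ (Fin (n + 1))) {i : Fin (n + 1)} (h : 0 < x.1 i)
    (h' : ∀ j, 0 < x.1 j → j ≤ i) : maxSupp x = i :=
  le_antisymm (h' _ (maxSupp_pos x)) (le_maxSupp x h)

namespace SimplexExt

variable {K L : Type} [Fintype K] [Fintype L]

set_option linter.unusedSectionVars false

open scoped Classical in
/-- The map of simplices induced by a map of vertices. -/
noncomputable def push (φ : L → K) (y : L → ℝ) : K → ℝ := fun k => ∑ i, if φ i = k then y i else 0

lemma continuous_push (φ : L → K) : Continuous (push φ) := by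
  refine continuous_pi fun k => continuous_finsetSum _ fun i _ => ?_
  by_cases h : φ i = k
  · simpa [h] using continuous_apply i
  · simpa [h] using continuous_const

lemma push_mem (φ : L → K) {y : L → ℝ} (hy : y ∈ stdSimplex ℝ L) : push φ y ∈ stdSimplex ℝ K := by
  refine ⟨fun k => Finset.sum_nonneg fun i _ => ?_, ?_⟩
  · split_ifs
    exacts [hy.1 i, le_rfl]
  · classical
    unfold push
    rw [Finset.sum_comm]
    simpa using hy.2

lemma push_pos_iff (φ : L → K) {y : L → ℝ} (hy : y ∈ stdSimplex ℝ L) (k : K) :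
    0 < push φ y k ↔ ∃ i, φ i = k ∧ 0 < y i := by
  unfold push
  rw [Finset.sum_pos_iff_of_nonneg fun i _ => by split_ifs; exacts [hy.1 i, le_rfl]]
  constructor
  · rintro ⟨i, -, hi⟩
    by_cases h : φ i = k
    · exact ⟨i, h, by simpa [h] using hi⟩
    · simp [h] at hi
  · rintro ⟨i, h, hi⟩
    exact ⟨i, Finset.mem_univ i, by simpa [h] using hi⟩

lemma push_push {N : Type} [Fintype N] (ψ : K → N) (φ : L → K) (y : L → ℝ) :
    push ψ (push φ y) = push (ψ ∘ φ) y := by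
  classical
  funext n
  have : ∀ (k : K) (i : L), (if ψ k = n then (if φ i = k then y i else 0) else 0) =
      if φ i = k then (if ψ (φ i) = n then y i else 0) else 0 := by
    intro k i
    by_cases h : φ i = k
    · simp [h]
    · simp [h]
  calc push ψ (push φ y) n = ∑ k, ∑ i, if ψ k = n then (if φ i = k then y i else 0) else 0 := by
        refine Finset.sum_congr rfl fun k _ => ?_
        by_cases h : ψ k = n
        · simp [h, push]
        · simp [h]
    _ = ∑ i, ∑ k, if φ i = k then (if ψ (φ i) = n then y i else 0) else 0 := by
        rw [Finset.sum_comm]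
        exact Finset.sum_congr rfl fun i _ => Finset.sum_congr rfl fun k _ => this k i
    _ = push (ψ ∘ φ) y n := by simp [push]

lemma push_id (y : L → ℝ) : push id y = y := by
  classical
  funext i; simp [push]

lemma push_injective_apply {φ : L → K} (hφ : Function.Injective φ) (y : L → ℝ) (i : L) :
    push φ y (φ i) = y i := by
  classical
  simp [push, hφ.eq_iff]

lemma push_comp {φ : L → K} (hφ : Function.Injective φ) {x : K → ℝ}
    (hx : ∀ k, k ∉ range φ → x k = 0) : push φ (x ∘ φ) = x := by
  funext k
  by_cases h : k ∈ range φ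
  · obtain ⟨i, rfl⟩ := h
    exact push_injective_apply hφ _ i
  · rw [hx k h]
    exact Finset.sum_eq_zero fun i _ => by rw [if_neg fun h' => h ⟨i, h'⟩]

lemma comp_mem {φ : L → K} (hφ : Function.Injective φ) {x : K → ℝ} (hx : x ∈ stdSimplex ℝ K)
    (hx' : ∀ k, k ∉ range φ → x k = 0) : x ∘ φ ∈ stdSimplex ℝ L := by
  refine ⟨fun i => hx.1 _, ?_⟩
  rw [← hx.2]
  conv_rhs => rw [← push_comp hφ hx']
  classical
  unfold push
  rw [Finset.sum_comm]
  simp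

section Extension

variable {P : Type} [PartialOrder P] {X : Type} [TopologicalSpace X] {s : X → P}

/-- The value of `g` at `x` lies in the stratum prescribed by the colors `κ` of the vertices of the
simplex carrying `x`. -/
def StratAt (s : X → P) {m : ℕ} (J : Fin (m + 1) → P) (κ : K → Fin (m + 1)) (g : (K → ℝ) → X)
    (x : K → ℝ) : Prop :=
  ∀ k, 0 < x k → (∀ l, 0 < x l → κ l ≤ κ k) → s (g x) = J (κ k)

/-- The face of the simplex spanned by the vertices in `τ`. -/
def face (τ : Finset K) : Set (K → ℝ) := {x ∈ stdSimplex ℝ K | ∀ k, k ∉ τ → x k = 0}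

lemma isClosed_face (τ : Finset K) : IsClosed (face τ) := by
  have : face τ = stdSimplex ℝ K ∩ ⋂ k : K, ⋂ _ : k ∉ τ, {x : K → ℝ | x k = 0} := by
    ext x; simp [face]
  rw [this]
  exact (isClosed_stdSimplex ℝ K).inter (isClosed_iInter fun k => isClosed_iInter fun _ =>
    isClosed_eq (continuous_apply k) continuous_const)

/-- The vertex `v` of the simplex `τ` is admissible with respect to the colors `κ`. -/
def AdmissibleVertex {m : ℕ} (κ : K → Fin (m + 1)) (τ : Finset K) (v : K) : Prop :=
  (∃ u ∈ τ, u ≠ v ∧ κ u = κ v) ∨ ∃ u ∈ τ, ∃ u' ∈ τ, κ u < κ v ∧ κ v < κ u'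

lemma AdmissibleVertex.isAdmissible {m : ℕ} {κ : K → Fin (m + 1)} {τ : Finset K} {v : K}
    (h : AdmissibleVertex κ τ v) (J : Fin (m + 1) → P) {n : ℕ} {ε : Fin (n + 1) → K}
    (hε : Monotone (κ ∘ ε)) (hτ : ∀ k, k ∈ τ ↔ ∃ i, ε i = k) {k : Fin (n + 1)} (hk : ε k = v) :
    IsAdmissible (J ∘ κ ∘ ε) k := by
  subst hk
  by_cases h0 : (k : ℕ) = 0
  · right; left
    have hk0 : k = 0 := Fin.ext h0
    subst hk0
    refine ⟨rfl, ?_⟩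
    rcases h with ⟨u, hu, hne, hc⟩ | ⟨u, hu, -, -, hc, -⟩
    · obtain ⟨i, rfl⟩ := (hτ u).1 hu
      have hi : i ≠ 0 := fun h => hne (by rw [h])
      have hi' : 0 < (i : ℕ) := Nat.pos_of_ne_zero fun h => hi (Fin.ext h)
      have hn : 0 < n := by omega
      refine ⟨hn, congrArg J (le_antisymm (hε (Fin.zero_le _)) ?_)⟩
      exact (hε (show (⟨1, by omega⟩ : Fin (n + 1)) ≤ i from hi')).trans hc.le
    · obtain ⟨i, rfl⟩ := (hτ u).1 hu
      exact absurd (hε (Fin.zero_le i)) (not_le.2 hc)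
  by_cases hn : (k : ℕ) = n
  · right; right
    have hkn : k = Fin.last n := Fin.ext hn
    subst hkn
    refine ⟨hn, ?_⟩
    rcases h with ⟨u, hu, hne, hc⟩ | ⟨-, -, u, hu, -, hc⟩
    · obtain ⟨i, rfl⟩ := (hτ u).1 hu
      have hi : i ≠ Fin.last n := fun h => hne (by rw [h])
      have hi' : (i : ℕ) < n := by
        have := i.2
        have : (i : ℕ) ≠ n := fun h => hi (Fin.ext h)
        omega
      refine ⟨by omega, congrArg J (le_antisymm (hε ?_) ?_)⟩
      · exact Fin.le_def.2 (by simp)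
      · refine hc.symm.le.trans (hε (Fin.le_def.2 ?_))
        simp only
        omega
    · obtain ⟨i, rfl⟩ := (hτ u).1 hu
      exact absurd (hε (Fin.le_last i)) (not_le.2 hc)
  · left
    have := k.2
    exact ⟨by omega, by omega⟩

lemma exists_sorted_enum {m : ℕ} (κ : K → Fin (m + 1)) {τ : Finset K} {v : K} (hv : v ∈ τ) :
    ∃ (n : ℕ) (ε : Fin (n + 1) → K), Function.Injective ε ∧ (∀ k, k ∈ τ ↔ ∃ i, ε i = k) ∧
      Monotone (κ ∘ ε) := by
  obtain ⟨n, hn⟩ : ∃ n, τ.card = n + 1 :=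
    Nat.exists_eq_succ_of_ne_zero (Finset.card_ne_zero_of_mem hv)
  let e := (τ.equivFinOfCardEq hn).symm
  let f : Fin (n + 1) → Fin (m + 1) := fun i => κ (e i)
  refine ⟨n, fun i => e (Tuple.sort f i), ?_, ?_, Tuple.monotone_sort f⟩
  · exact Subtype.val_injective.comp (e.injective.comp (Tuple.sort f).injective)
  · refine fun k => ⟨fun hk => ⟨(Tuple.sort f).symm (e.symm ⟨k, hk⟩), by simp⟩, ?_⟩
    rintro ⟨i, rfl⟩
    exact (e _).2

/-- Filling of a horn at an admissible vertex, for a simplex with unordered vertices. -/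
lemma exists_horn_filling (hs : DiagFibrant s) {m : ℕ} {J : Fin (m + 1) → P} (hJ : Monotone J)
    (κ : K → Fin (m + 1)) {τ : Finset K} {v : K} (hv : v ∈ τ) (hadm : AdmissibleVertex κ τ v)
    (g : (K → ℝ) → X) (hg : ContinuousOn g {x ∈ face τ | ∃ a ∈ τ, a ≠ v ∧ x a = 0})
    (hgs : ∀ x ∈ face τ, (∃ a ∈ τ, a ≠ v ∧ x a = 0) → StratAt s J κ g x) :
    ∃ g' : (K → ℝ) → X, ContinuousOn g' (face τ) ∧ (∀ x ∈ face τ, StratAt s J κ g' x) ∧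
      ∀ x ∈ face τ, (∃ a ∈ τ, a ≠ v ∧ x a = 0) → g' x = g x := by
  classical
  obtain ⟨n, ε, hinj, hτ, hmono⟩ := exists_sorted_enum κ hv
  obtain ⟨k, hk⟩ := (hτ v).1 hv
  have hpush : ∀ y : stdSimplex ℝ (Fin (n + 1)), push ε y.1 ∈ face τ := fun y =>
    ⟨push_mem ε y.2, fun l hl => by
      by_contra hne
      obtain ⟨i, hi, -⟩ := (push_pos_iff ε y.2 l).1 (((push_mem ε y.2).1 l).lt_of_ne' hne)
      exact hl ((hτ l).2 ⟨i, hi⟩)⟩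
  have hhorn : ∀ y : hornSet n k, ∃ a ∈ τ, a ≠ v ∧ push ε y.1.1 a = 0 := by
    rintro ⟨y, i, hik, hi⟩
    refine ⟨ε i, (hτ _).2 ⟨i, rfl⟩, fun h => hik (hinj (h.trans hk.symm)), ?_⟩
    rw [push_injective_apply hinj]
    exact hi
  obtain ⟨g₀, hg₀, hg₀s, hg₀e⟩ := hs n (J ∘ κ ∘ ε) (hJ.comp hmono) k
    (hadm.isAdmissible J hmono hτ hk) (fun y => g (push ε y.1.1))
    (hg.comp_continuous ((continuous_push ε).comp
        (continuous_subtype_val.comp continuous_subtype_val)) fun y => ⟨hpush y.1, hhorn y⟩)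
    (fun y => by
      refine hgs _ (hpush y.1) (hhorn y) (ε (maxSupp y.1)) ?_ ?_
      · rw [push_injective_apply hinj]; exact maxSupp_pos y.1
      · intro l hl
        obtain ⟨i, rfl, hi⟩ := (push_pos_iff ε y.1.2 l).1 hl
        exact hmono (le_maxSupp y.1 hi))
  have hcomp : ∀ x ∈ face τ, x ∘ ε ∈ stdSimplex ℝ (Fin (n + 1)) := fun x hx =>
    comp_mem hinj hx.1 fun l hl => hx.2 l fun h => hl ((hτ l).1 h)
  refine ⟨fun x => if h : x ∈ face τ then g₀ ⟨x ∘ ε, hcomp x h⟩ else g x, ?_, ?_, ?_⟩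
  · rw [continuousOn_iff_continuous_domRestrict]
    have : (face τ).domRestrict
        (fun x => if h : x ∈ face τ then g₀ ⟨x ∘ ε, hcomp x h⟩ else g x) =
        fun x : face τ => g₀ ⟨x.1 ∘ ε, hcomp x.1 x.2⟩ := by
      funext x
      exact dif_pos x.2
    rw [this]
    refine hg₀.comp (Continuous.subtype_mk ?_ _)
    exact continuous_pi fun i => (continuous_apply (ε i)).comp continuous_subtype_val
  · intro x hx l hl hmax
    simp only [hx, dif_pos]
    rw [hg₀s]
    refine congrArg J (le_antisymm (hmax _ (maxSupp_pos ⟨x ∘ ε, hcomp x hx⟩)) ?_)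
    have hlτ : l ∈ τ := by
      by_contra h
      exact hl.ne' (hx.2 l h)
    obtain ⟨i, rfl⟩ := (hτ l).1 hlτ
    exact hmono (le_maxSupp ⟨x ∘ ε, hcomp x hx⟩ hl)
  · rintro x hx ⟨a, haτ, hav, ha⟩
    obtain ⟨i, rfl⟩ := (hτ a).1 haτ
    simp only [hx, dif_pos]
    have := hg₀e ⟨⟨x ∘ ε, hcomp x hx⟩, i, fun h => hav (by rw [h, hk]), ha⟩
    rw [this]
    change g (push ε (x ∘ ε)) = g x
    rw [push_comp hinj fun l hl => hx.2 l fun h => hl ((hτ l).1 h)]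

end Extension

end SimplexExt

namespace SimplexExt

variable {K L : Type} [Fintype K] [Fintype L]

set_option linter.unusedSectionVars false

open scoped Classical in
/-- The set of vertices with positive barycentric coordinate. -/
noncomputable def supp (x : K → ℝ) : Finset K := Finset.univ.filter fun k => 0 < x k

lemma mem_supp {x : K → ℝ} {k : K} : k ∈ supp x ↔ 0 < x k := by simp [supp]

lemma mem_face_iff {x : K → ℝ} {τ : Finset K} :
    x ∈ face τ ↔ x ∈ stdSimplex ℝ K ∧ supp x ⊆ τ := by
  refine and_congr_right fun hx => ⟨fun h k hk => ?_, fun h k hk => ?_⟩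
  · by_contra hkτ
    exact (mem_supp.1 hk).ne' (h k hkτ)
  · by_contra hne
    exact hk (h (mem_supp.2 ((hx.1 k).lt_of_ne' hne)))

/-- The realization of a simplicial complex with vertices in `K`. -/
def realization (𝓛 : Set (Finset K)) : Set (K → ℝ) := {x ∈ stdSimplex ℝ K | supp x ∈ 𝓛}

lemma isClosed_realization {𝓛 : Set (Finset K)} (h : IsLowerSet 𝓛) : IsClosed (realization 𝓛) := by
  have : realization 𝓛 = ⋃ ω ∈ 𝓛, face ω := by
    ext x
    simp only [mem_iUnion, mem_face_iff, exists_prop]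
    exact ⟨fun hx => ⟨_, hx.2, hx.1, subset_rfl⟩, fun ⟨ω, hω, hx, hs⟩ => ⟨hx, h hs hω⟩⟩
  rw [this]
  exact (Set.toFinite 𝓛).isClosed_biUnion fun ω _ => isClosed_face ω

section Toggle

variable {P : Type} [PartialOrder P] {X : Type} [TopologicalSpace X] {s : X → P}

lemma StratAt.congr {m : ℕ} {J : Fin (m + 1) → P} {κ : K → Fin (m + 1)} {g g' : (K → ℝ) → X}
    {x : K → ℝ} (h : StratAt s J κ g x) (h' : g' x = g x) : StratAt s J κ g' x :=
  fun k hk hmax => (congrArg s h').trans (h k hk hmax)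

lemma exists_elementary_extension [DecidableEq K] (hs : DiagFibrant s) {m : ℕ}
    {J : Fin (m + 1) → P} (hJ : Monotone J) (κ : K → Fin (m + 1)) {𝓛 : Set (Finset K)}
    (h𝓛 : IsLowerSet 𝓛) {τ : Finset K} {v : K} (hv : v ∈ τ) (hadm : AdmissibleVertex κ τ v)
    (hmiss : τ.erase v ∉ 𝓛) (hfaces : ∀ a ∈ τ, a ≠ v → τ.erase a ∈ 𝓛)
    (g : (K → ℝ) → X) (hg : ContinuousOn g (realization 𝓛))
    (hgs : ∀ x ∈ realization 𝓛, StratAt s J κ g x) :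
    ∃ g' : (K → ℝ) → X, ContinuousOn g' (realization (𝓛 ∪ {ρ | ρ ⊆ τ})) ∧
      (∀ x ∈ realization (𝓛 ∪ {ρ | ρ ⊆ τ}), StratAt s J κ g' x) ∧
      ∀ x ∈ realization 𝓛, g' x = g x := by
  classical
  have hhorn : {x ∈ face τ | ∃ a ∈ τ, a ≠ v ∧ x a = 0} ⊆ realization 𝓛 := by
    rintro x ⟨hx, a, haτ, hav, ha⟩
    rw [mem_face_iff] at hx
    refine ⟨hx.1, h𝓛 (fun k hk => ?_) (hfaces a haτ hav)⟩
    refine Finset.mem_erase.2 ⟨?_, hx.2 hk⟩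
    rintro rfl
    exact (mem_supp.1 hk).ne' ha
  obtain ⟨g₁, hg₁, hg₁s, hg₁e⟩ := exists_horn_filling hs hJ κ hv hadm g (hg.mono hhorn)
    fun x hx hx' => hgs x (hhorn ⟨hx, hx'⟩)
  let g' : (K → ℝ) → X := fun x => if supp x ∈ 𝓛 then g x else g₁ x
  have h1 : ∀ x ∈ realization 𝓛, g' x = g x := fun x hx => if_pos hx.2
  have h2 : ∀ x ∈ face τ, g' x = g₁ x := by
    intro x hx
    by_cases h : supp x ∈ 𝓛
    · rw [show g' x = g x from if_pos h]
      refine (hg₁e x hx ?_).symm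
      by_contra! hne
      refine hmiss (h𝓛 (fun k hk => mem_supp.2 ?_) h)
      exact (hx.1.1 k).lt_of_ne' (hne k (Finset.mem_of_mem_erase hk) (Finset.ne_of_mem_erase hk))
    · exact if_neg h
  have hun : realization (𝓛 ∪ {ρ | ρ ⊆ τ}) = realization 𝓛 ∪ face τ := by
    ext x
    simp only [realization, mem_ofPred_eq, mem_union, mem_face_iff]
    tauto
  refine ⟨g', ?_, ?_, h1⟩
  · rw [hun]
    exact (hg.congr h1).union_of_isClosed (hg₁.congr h2) (isClosed_realization h𝓛) (isClosed_face τ)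
  · rw [hun]
    rintro x (hx | hx)
    exacts [(hgs x hx).congr (h1 x hx), (hg₁s x hx).congr (h2 x hx)]

/-- Extension of stratified maps from a subcomplex, by a discrete Morse argument: the missing
simplices are paired up by inserting or removing the vertex `v q`, where `q` has the largest rank
such that the simplex contains `u q`. -/
theorem exists_extension [DecidableEq K] (hs : DiagFibrant s) {m : ℕ} {J : Fin (m + 1) → P}
    (hJ : Monotone J) (κ : K → Fin (m + 1)) {𝓛 : Set (Finset K)} (h𝓛 : IsLowerSet 𝓛)
    {Q : Type} [Finite Q] (u v : Q → K) (huv : ∀ q q', u q ≠ v q')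
    (hex : ∀ ω, ω ∉ 𝓛 → ∃ q, u q ∈ ω)
    (herase : ∀ ω q, ω ∉ 𝓛 → u q ∈ ω → ω.erase (v q) ∉ 𝓛)
    (hadm : ∀ ω q, ω ∉ 𝓛 → u q ∈ ω → AdmissibleVertex κ (insert (v q) ω) (v q))
    (g : (K → ℝ) → X) (hg : ContinuousOn g (realization 𝓛))
    (hgs : ∀ x ∈ realization 𝓛, StratAt s J κ g x) :
    ∃ g' : (K → ℝ) → X, ContinuousOn g' (stdSimplex ℝ K) ∧
      (∀ x ∈ stdSimplex ℝ K, StratAt s J κ g' x) ∧ ∀ x ∈ realization 𝓛, g' x = g x := by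
  classical
  obtain ⟨N, ⟨e⟩⟩ := Finite.exists_equiv_fin Q
  let ν : Q → ℕ := fun q => e q
  have hν : Function.Injective ν := fun q q' h => e.injective (Fin.ext h)
  let IsTop : Finset K → Q → Prop := fun ω q => u q ∈ ω ∧ ∀ q', u q' ∈ ω → ν q' ≤ ν q
  have top_unique : ∀ {ω q q'}, IsTop ω q → IsTop ω q' → q = q' := fun h h' =>
    hν (le_antisymm (h'.2 _ h.1) (h.2 _ h'.1))
  have top_exists : ∀ ω, ω ∉ 𝓛 → ∃ q, IsTop ω q := by
    intro ω hω
    obtain ⟨q, hq, hmax⟩ := Set.exists_max_image {q | u q ∈ ω} ν (Set.toFinite _) (hex ω hω)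
    exact ⟨q, hq, hmax⟩
  have top_erase : ∀ {ω q} q', IsTop ω q ↔ IsTop (ω.erase (v q')) q := by
    intro ω q q'
    simp only [IsTop, Finset.mem_erase, ne_eq, huv, not_false_eq_true, true_and]
  suffices H : ∀ 𝓜 : Set (Finset K), IsLowerSet 𝓜 → 𝓛 ⊆ 𝓜 →
      (∀ ω q, ω ∉ 𝓜 → IsTop ω q → ω.erase (v q) ∉ 𝓜) → ∀ g : (K → ℝ) → X,
      ContinuousOn g (realization 𝓜) → (∀ x ∈ realization 𝓜, StratAt s J κ g x) →
      ∃ g' : (K → ℝ) → X, ContinuousOn g' (stdSimplex ℝ K) ∧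
      (∀ x ∈ stdSimplex ℝ K, StratAt s J κ g' x) ∧ ∀ x ∈ realization 𝓜, g' x = g x from
    H 𝓛 h𝓛 subset_rfl (fun ω q hω hq => herase ω q hω hq.1) g hg hgs
  intro 𝓜
  induction 𝓜 using WellFoundedGT.induction with
  | ind 𝓜 ih =>
  intro h𝓜 hsub hinv g hg hgs
  by_cases hall : ∀ ω, ω ∈ 𝓜
  · have : realization 𝓜 = stdSimplex ℝ K := by
      ext x; simp [realization, hall]
    rw [this] at hg hgs
    exact ⟨g, hg, hgs, fun _ _ => rfl⟩
  push Not at hall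
  let S : Set (Finset K × Q) := {a | a.1 ∉ 𝓜 ∧ IsTop a.1 a.2}
  have hS : S.Nonempty := by
    obtain ⟨ω, hω⟩ := hall
    obtain ⟨q, hq⟩ := top_exists ω fun h => hω (hsub h)
    exact ⟨(ω, q), hω, hq⟩
  let c : Finset K × Q → ℕ := fun a => ν a.2 * (Fintype.card K + 1) + a.1.card
  obtain ⟨⟨ω, q⟩, ⟨hω, hq⟩, hmin⟩ := Set.exists_min_image S c (Set.toFinite S) hS
  have hcard : ∀ ρ : Finset K, ρ.card < Fintype.card K + 1 := fun ρ =>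
    Nat.lt_succ_of_le (Finset.card_le_univ ρ)
  have hle : ∀ ρ q', ρ ∉ 𝓜 → IsTop ρ q' → ν q' ≤ ν q → q' = q ∧ ω.card ≤ ρ.card := by
    intro ρ q' hρ hq' hνq
    have h : ν q * (Fintype.card K + 1) + ω.card ≤ ν q' * (Fintype.card K + 1) + ρ.card :=
      hmin (ρ, q') ⟨hρ, hq'⟩
    have h' := hcard ρ
    have : ν q' = ν q := by
      refine le_antisymm hνq (not_lt.1 fun hlt => ?_)
      have := Nat.mul_le_mul_right (Fintype.card K + 1) (Nat.succ_le_of_lt hlt)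
      rw [Nat.succ_mul] at this
      omega
    rw [this] at h
    exact ⟨hν this, by omega⟩
  have hω𝓛 : ω ∉ 𝓛 := fun h => hω (hsub h)
  have hvω : v q ∉ ω := by
    intro hv
    have := (hle _ q (hinv ω q hω hq) ((top_erase q).1 hq) le_rfl).2
    have := Finset.card_erase_lt_of_mem hv
    omega
  have hfaces : ∀ a ∈ insert (v q) ω, a ≠ v q → (insert (v q) ω).erase a ∈ 𝓜 := by
    intro a ha hav
    by_contra hmiss
    have haω : a ∈ ω := (Finset.mem_insert.1 ha).resolve_left hav
    obtain ⟨q', hq'⟩ := top_exists _ fun h => hmiss (hsub h)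
    have hνq : ν q' ≤ ν q := hq.2 _
      ((Finset.mem_insert.1 (Finset.mem_of_mem_erase hq'.1)).resolve_left (huv _ _))
    obtain ⟨rfl, -⟩ := hle _ q' hmiss hq' hνq
    have h1 := hinv _ _ hmiss hq'
    have h2 : ((insert (v q') ω).erase a).erase (v q') = ω.erase a := by
      rw [Finset.erase_right_comm, Finset.erase_insert hvω]
    have h3 := (top_erase q').1 hq'
    rw [h2] at h1 h3
    have := (hle _ _ h1 h3 le_rfl).2
    have := Finset.card_erase_lt_of_mem haω
    omega
  obtain ⟨g₁, hg₁, hg₁s, hg₁e⟩ := exists_elementary_extension hs hJ κ h𝓜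
    (Finset.mem_insert_self _ _) (hadm ω q hω𝓛 hq.1)
    (by rwa [Finset.erase_insert hvω]) hfaces g hg hgs
  have hlt : 𝓜 < 𝓜 ∪ {ρ | ρ ⊆ insert (v q) ω} :=
    ⟨subset_union_left, fun h => hω (h (Or.inr (Finset.subset_insert _ _)))⟩
  obtain ⟨g', hg', hg's, hg'e⟩ := ih _ hlt
    (h𝓜.union fun a b hba ha => hba.trans ha) (hsub.trans subset_union_left)
    (by
      rintro ρ q' hρ hq' (h | h)
      · exact hinv ρ q' (fun h => hρ (Or.inl h)) hq' h
      · have hmiss := hinv ρ q' (fun h => hρ (Or.inl h)) hq'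
        have hρω : ω ⊆ ρ := by
          intro a ha
          by_contra haρ
          refine hmiss (h𝓜 (fun b hb => ?_) (hfaces a (Finset.mem_insert_of_mem ha)
            fun h => hvω (h ▸ ha)))
          refine Finset.mem_erase.2 ⟨?_, h hb⟩
          rintro rfl
          exact haρ (Finset.mem_of_mem_erase hb)
        have : ν q' ≤ ν q := hq.2 _ ((Finset.mem_insert.1
          (h (Finset.mem_erase.2 ⟨huv _ _, hq'.1⟩))).resolve_left (huv _ _))
        obtain rfl : q' = q := hν (le_antisymm this (hq'.2 _ (hρω hq.1)))
        refine hρ (Or.inr fun b hb => ?_)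
        by_cases hbv : b = v q'
        · exact hbv ▸ Finset.mem_insert_self _ _
        · exact h (Finset.mem_erase.2 ⟨hbv, hb⟩)) g₁ hg₁ hg₁s
  refine ⟨g', hg', hg's, fun x hx => ?_⟩
  rw [hg'e x ⟨hx.1, Or.inl hx.2⟩, hg₁e x hx]

end Toggle

end SimplexExt

namespace SimplexExt

variable {K L : Type} [Fintype K] [Fintype L]

set_option linter.unusedSectionVars false

/-- The map of simplices induced by a map of vertices, as a continuous map. -/
noncomputable def simplexMap (φ : L → K) : C(stdSimplex ℝ L, stdSimplex ℝ K) :=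
  ⟨fun x => ⟨push φ x.1, push_mem φ x.2⟩,
    ((continuous_push φ).comp continuous_subtype_val).subtype_mk _⟩

lemma simplexMap_simplexMap {N : Type} [Fintype N] (ψ : K → N) (φ : L → K) (x : stdSimplex ℝ L) :
    simplexMap ψ (simplexMap φ x) = simplexMap (ψ ∘ φ) x := Subtype.ext (push_push ψ φ x.1)

lemma simplexMap_id (x : stdSimplex ℝ L) : simplexMap id x = x := Subtype.ext (push_id x.1)

lemma simplexMap_leftInverse {φ : L → K} {r : K → L} (h : Function.LeftInverse r φ)
    (x : stdSimplex ℝ L) : simplexMap r (simplexMap φ x) = x := by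
  rw [simplexMap_simplexMap, h.comp_eq_id, simplexMap_id]

lemma simplexMap_of_supported {φ : L → K} {r : K → L} (h : Function.LeftInverse r φ)
    {x : stdSimplex ℝ K} (hx : ∀ k, k ∉ range φ → x.1 k = 0) :
    simplexMap φ (simplexMap r x) = x := by
  obtain ⟨x', rfl⟩ : ∃ x', simplexMap φ x' = x :=
    ⟨⟨_, comp_mem h.injective x.2 hx⟩, Subtype.ext (push_comp h.injective hx)⟩
  rw [simplexMap_leftInverse h]

lemma simplexMap_supported (φ : L → K) (x : stdSimplex ℝ L) (k : K) (hk : k ∉ range φ) :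
    (simplexMap φ x).1 k = 0 := by
  by_contra h
  obtain ⟨i, hi, -⟩ := (push_pos_iff φ x.2 k).1 ((push_mem φ x.2).1 k |>.lt_of_ne' h)
  exact hk ⟨i, hi⟩

lemma isClosed_supported (T : Set K) : IsClosed {x : stdSimplex ℝ K | ∀ k, k ∉ T → x.1 k = 0} := by
  have : {x : stdSimplex ℝ K | ∀ k, k ∉ T → x.1 k = 0} =
      ⋂ k : K, ⋂ _ : k ∉ T, {x : stdSimplex ℝ K | x.1 k = 0} := by
    ext x; simp
  rw [this]
  exact isClosed_iInter fun k => isClosed_iInter fun _ =>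
    isClosed_eq ((continuous_apply k).comp continuous_subtype_val) continuous_const

/-- The weight of an endpoint of the interval. -/
def weight (y : I) (b : Bool) : ℝ := if b then y else 1 - y

lemma weight_nonneg (y : I) (b : Bool) : 0 ≤ weight y b := by
  unfold weight
  split_ifs
  exacts [y.2.1, sub_nonneg.2 y.2.2]

/-- The section of the projection of the simplex on the vertices of the prism to the prism. -/
def prismSection {N : ℕ} (x : L → ℝ) (y : Fin N → I) (k : L × (Fin N → Bool)) : ℝ :=
  x k.1 * ∏ j, weight (y j) (k.2 j)

lemma sum_prod_weight {N : ℕ} (y : Fin N → I) : ∑ ε : Fin N → Bool, ∏ j, weight (y j) (ε j) = 1 := by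
  have := Finset.prod_univ_sum (fun _ : Fin N => (Finset.univ : Finset Bool))
    (fun j b => weight (y j) b)
  rw [Fintype.piFinset_univ] at this
  rw [← this]
  simp [weight]

lemma sum_prod_weight_true {N : ℕ} (y : Fin N → I) (j : Fin N) :
    ∑ ε : Fin N → Bool, (if ε j = true then ∏ j, weight (y j) (ε j) else 0) = y j := by
  have := Finset.prod_univ_sum (fun _ : Fin N => (Finset.univ : Finset Bool))
    (fun l b => weight (y l) b * if l = j then (if b = true then 1 else 0) else 1)
  rw [Fintype.piFinset_univ] at this
  trans ∏ l, ∑ b, weight (y l) b * if l = j then (if b = true then 1 else 0) else 1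
  · rw [this]
    refine Finset.sum_congr rfl fun ε _ => ?_
    rw [Finset.prod_mul_distrib, Finset.prod_ite_eq' Finset.univ j]
    simp
  · rw [Finset.prod_eq_single j]
    · simp [weight]
    · intro l _ hl
      simp [weight, hl]
    · simp

lemma prismSection_mem {N : ℕ} {x : L → ℝ} (hx : x ∈ stdSimplex ℝ L) (y : Fin N → I) :
    prismSection x y ∈ stdSimplex ℝ (L × (Fin N → Bool)) := by
  refine ⟨fun k => mul_nonneg (hx.1 _) (Finset.prod_nonneg fun j _ => weight_nonneg _ _), ?_⟩
  rw [Fintype.sum_prod_type]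
  simp only [prismSection, ← Finset.mul_sum, sum_prod_weight, mul_one]
  exact hx.2

lemma push_fst_prismSection {N : ℕ} (x : L → ℝ) (y : Fin N → I) :
    push Prod.fst (prismSection x y) = x := by
  classical
  funext i
  unfold push
  rw [Fintype.sum_prod_type, Finset.sum_eq_single i]
  · simp only [prismSection, ← Finset.mul_sum, sum_prod_weight, mul_one, if_true]
  · intro i' _ hi'
    simp [hi']
  · simp

lemma push_snd_prismSection {N : ℕ} {x : L → ℝ} (hx : x ∈ stdSimplex ℝ L) (y : Fin N → I)
    (j : Fin N) :
    push (fun k : L × (Fin N → Bool) => k.2 j) (prismSection x y) true = y j := by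
  classical
  unfold push
  rw [Fintype.sum_prod_type]
  have : ∀ i : L, (∑ ε : Fin N → Bool, if ε j = true then prismSection x y (i, ε) else 0) =
      x i * y j := by
    intro i
    rw [← sum_prod_weight_true y j, Finset.mul_sum]
    refine Finset.sum_congr rfl fun ε _ => ?_
    simp [prismSection]
  calc _ = ∑ i, x i * y j := Finset.sum_congr rfl fun i _ => by
        rw [← this i]
        exact Finset.sum_congr rfl fun ε _ => by congr
    _ = y j := by rw [← Finset.sum_mul, hx.2, one_mul]

lemma continuous_prismSection {N : ℕ} :
    Continuous fun a : (L → ℝ) × (Fin N → I) => prismSection a.1 a.2 := by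
  refine continuous_pi fun k => ?_
  unfold prismSection
  refine ((continuous_apply k.1).comp continuous_fst).mul (continuous_finsetProd _ fun j _ => ?_)
  have : Continuous fun a : (L → ℝ) × (Fin N → I) => ((a.2 j : I) : ℝ) :=
    continuous_subtype_val.comp ((continuous_apply j).comp continuous_snd)
  unfold weight
  by_cases h : k.2 j = true
  · simpa [h] using this
  · simp only [h]
    exact continuous_const.sub this

/-- The cube coordinates of a point in the simplex on the vertices of the prism. -/
noncomputable def cubeCoord {N : ℕ} (z : stdSimplex ℝ (L × (Fin N → Bool))) : Fin N → I := fun j =>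
  ⟨(simplexMap (fun k : L × (Fin N → Bool) => k.2 j) z).1 true,
    mem_Icc_of_mem_stdSimplex (simplexMap _ z).2 true⟩

lemma continuous_cubeCoord {N : ℕ} :
    Continuous (cubeCoord : stdSimplex ℝ (L × (Fin N → Bool)) → Fin N → I) :=
  continuous_pi fun _ => Continuous.subtype_mk
    ((continuous_apply true).comp (continuous_subtype_val.comp (simplexMap _).continuous)) _

lemma cubeCoord_pos_iff {N : ℕ} (z : stdSimplex ℝ (L × (Fin N → Bool))) (j : Fin N) :
    0 < (cubeCoord z j : ℝ) ↔ ∃ k, k.2 j = true ∧ 0 < z.1 k :=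
  push_pos_iff _ z.2 true

lemma cubeCoord_lt_one_iff {N : ℕ} (z : stdSimplex ℝ (L × (Fin N → Bool))) (j : Fin N) :
    (cubeCoord z j : ℝ) < 1 ↔ ∃ k, k.2 j = false ∧ 0 < z.1 k := by
  rw [← push_pos_iff (fun k : L × (Fin N → Bool) => k.2 j) z.2 false]
  have := (simplexMap (fun k : L × (Fin N → Bool) => k.2 j) z).2.2
  rw [Fintype.sum_bool] at this
  change (simplexMap (fun k : L × (Fin N → Bool) => k.2 j) z).1 true < 1 ↔
    0 < (simplexMap (fun k : L × (Fin N → Bool) => k.2 j) z).1 false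
  constructor <;> intro h <;> linarith

lemma prismSection_pos {N : ℕ} {x : L → ℝ} {y : Fin N → I} {k : L × (Fin N → Bool)}
    (hx : x ∈ stdSimplex ℝ L) (h : 0 < prismSection x y k) : 0 < x k.1 ∧ ∀ j, 0 < weight (y j) (k.2 j) := by
  refine ⟨(hx.1 _).lt_of_ne' fun h0 => ?_, fun j => (weight_nonneg _ _).lt_of_ne' fun h0 => ?_⟩
  · simp [prismSection, h0] at h
  · rw [prismSection, Finset.prod_eq_zero (Finset.mem_univ j) h0] at h
    simp at h

section Prism

variable {P : Type} [PartialOrder P] {X : Type} [TopologicalSpace X] {s : X → P}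

/-- Extension of stratified maps over a prism, from the realization of a subcomplex of the simplex
on its vertices. -/
theorem exists_prism_extension (hs : DiagFibrant s) {m N : ℕ} {J : Fin (m + 1) → P}
    (hJ : Monotone J) {𝓛 : Set (Finset (Fin (m + 1) × (Fin N → Bool)))} (h𝓛 : IsLowerSet 𝓛)
    {Q : Type} [Finite Q] (u v : Q → Fin (m + 1) × (Fin N → Bool)) (huv : ∀ q q', u q ≠ v q')
    (hex : ∀ ω, ω ∉ 𝓛 → ∃ q, u q ∈ ω)
    (herase : ∀ ω q, ω ∉ 𝓛 → u q ∈ ω → ω.erase (v q) ∉ 𝓛)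
    (hadm : ∀ ω q, ω ∉ 𝓛 → u q ∈ ω → AdmissibleVertex Prod.fst (insert (v q) ω) (v q))
    {A : Set (stdSimplex ℝ (Fin (m + 1)) × (Fin N → I))}
    (hA : ∀ z : stdSimplex ℝ (Fin (m + 1) × (Fin N → Bool)), supp z.1 ∈ 𝓛 →
      (simplexMap Prod.fst z, cubeCoord z) ∈ A)
    (hA' : ∀ a ∈ A, supp (prismSection a.1.1 a.2) ∈ 𝓛)
    (F : stdSimplex ℝ (Fin (m + 1)) × (Fin N → I) → X) (hF : ContinuousOn F A)
    (hFs : ∀ a ∈ A, s (F a) = flagStrat J a.1) :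
    ∃ G : C(Fin N → I, Holink s J), ∀ a ∈ A, (G a.2).1 a.1 = F a := by
  classical
  let R : stdSimplex ℝ (Fin (m + 1) × (Fin N → Bool)) → stdSimplex ℝ (Fin (m + 1)) × (Fin N → I) :=
    fun z => (simplexMap Prod.fst z, cubeCoord z)
  have hR : Continuous R := (simplexMap _).continuous.prodMk continuous_cubeCoord
  have hSmem : ∀ a : stdSimplex ℝ (Fin (m + 1)) × (Fin N → I),
      prismSection a.1.1 a.2 ∈ stdSimplex ℝ (Fin (m + 1) × (Fin N → Bool)) :=
    fun a => prismSection_mem a.1.2 a.2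
  have hRS : ∀ a : stdSimplex ℝ (Fin (m + 1)) × (Fin N → I), R ⟨_, hSmem a⟩ = a := by
    intro a
    refine Prod.ext (Subtype.ext (push_fst_prismSection a.1.1 a.2)) ?_
    funext j
    exact Subtype.ext (push_snd_prismSection a.1.2 a.2 j)
  obtain ⟨x₀⟩ : Nonempty X :=
    ⟨F (R ⟨_, single_mem_stdSimplex ℝ (0, fun _ => false)⟩)⟩
  let g : (Fin (m + 1) × (Fin N → Bool) → ℝ) → X := fun z =>
    if h : z ∈ stdSimplex ℝ (Fin (m + 1) × (Fin N → Bool)) then F (R ⟨z, h⟩) else x₀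
  have hgz : ∀ z : stdSimplex ℝ (Fin (m + 1) × (Fin N → Bool)), g z.1 = F (R z) :=
    fun z => dif_pos z.2
  obtain ⟨g', hg', hg's, hg'e⟩ := exists_extension hs hJ Prod.fst h𝓛 u v huv hex herase hadm g
    (by
      rw [continuousOn_iff_continuous_domRestrict]
      have : (realization 𝓛).domRestrict g = fun z => F (R ⟨z.1, z.2.1⟩) :=
        funext fun z => hgz ⟨z.1, z.2.1⟩
      rw [this]
      exact hF.comp_continuous (hR.comp (continuous_subtype_val.subtype_mk _))
        fun z => hA _ z.2.2)
    (by
      intro z hz k hk hmax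
      rw [hgz ⟨z, hz.1⟩, hFs _ (hA _ hz.2)]
      refine congrArg J (maxSupp_eq _ ((push_pos_iff _ hz.1 _).2 ⟨k, rfl, hk⟩) ?_)
      intro i hi
      obtain ⟨l, rfl, hl⟩ := (push_pos_iff _ hz.1 _).1 hi
      exact hmax l hl)
  let F' : (Fin N → I) × stdSimplex ℝ (Fin (m + 1)) → X := fun a => g' (prismSection a.2.1 a.1)
  have hF' : Continuous F' := hg'.comp_continuous
    (continuous_prismSection.comp ((continuous_subtype_val.comp continuous_snd).prodMk
      continuous_fst)) fun a => hSmem (a.2, a.1)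
  refine ⟨⟨fun y => ⟨ContinuousMap.curry ⟨F', hF'⟩ y, fun x => ?_⟩,
    (ContinuousMap.curry ⟨F', hF'⟩).continuous.subtype_mk _⟩, ?_⟩
  · change s (g' (prismSection x.1 y)) = J (maxSupp x)
    refine hg's _ (hSmem (x, y)) (maxSupp x, fun j => decide (0 < y j)) ?_ ?_
    · refine mul_pos (maxSupp_pos x) (Finset.prod_pos fun j _ => ?_)
      by_cases h : 0 < y j
      · simp [weight, h]
      · have : y j = 0 := le_antisymm (not_lt.1 h) (y j).2.1
        simp [weight, this]
    · intro l hl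
      exact le_maxSupp x (prismSection_pos x.2 hl).1
  · intro a ha
    change g' (prismSection a.1.1 a.2) = F a
    rw [hg'e _ ⟨hSmem a, hA' a ha⟩, hgz ⟨_, hSmem a⟩, hRS]

end Prism

end SimplexExt

namespace SimplexExt

set_option linter.unusedSectionVars false

open HtpyLoc

lemma exists_glue {A X : Type} [TopologicalSpace A] [TopologicalSpace X] {S T : Set A}
    (hS : IsClosed S) (hT : IsClosed T) (f g : A → X) (hf : ContinuousOn f S)
    (hg : ContinuousOn g T) (h : ∀ a ∈ S, a ∈ T → f a = g a) :
    ∃ F : A → X, ContinuousOn F (S ∪ T) ∧ (∀ a ∈ S, F a = f a) ∧ ∀ a ∈ T, F a = g a := by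
  classical
  have h1 : ∀ a ∈ S, S.piecewise f g a = f a := fun a ha => by simp [ha]
  have h2 : ∀ a ∈ T, S.piecewise f g a = g a := fun a ha => by
    by_cases haS : a ∈ S
    · rw [h1 a haS, h a haS ha]
    · simp [haS]
  exact ⟨_, (hf.congr h1).union_of_isClosed (hg.congr h2) hS hT, h1, h2⟩

section Coordinates

variable {L : Type} [Fintype L] {N : ℕ}

lemma eq_false_of_prismSection_pos {x : L → ℝ} {y : Fin N → I} {k : L × (Fin N → Bool)}
    (hx : x ∈ stdSimplex ℝ L) (h : 0 < prismSection x y k) {j : Fin N} (hj : y j = 0) :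
    k.2 j = false := by
  have := (prismSection_pos hx h).2 j
  by_contra hne
  rw [Bool.eq_true_of_not_eq_false hne] at this
  simp [weight, hj] at this

lemma eq_true_of_prismSection_pos {x : L → ℝ} {y : Fin N → I} {k : L × (Fin N → Bool)}
    (hx : x ∈ stdSimplex ℝ L) (h : 0 < prismSection x y k) {j : Fin N} (hj : y j = 1) :
    k.2 j = true := by
  have := (prismSection_pos hx h).2 j
  by_contra hne
  rw [Bool.eq_false_of_not_eq_true hne] at this
  simp [weight, hj] at this

lemma cubeCoord_eq_zero {z : stdSimplex ℝ (L × (Fin N → Bool))} {j : Fin N}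
    (h : ∀ k ∈ supp z.1, k.2 j = false) : cubeCoord z j = 0 := by
  by_contra hne
  obtain ⟨k, hk, hk'⟩ := (cubeCoord_pos_iff z j).1
    ((cubeCoord z j).2.1.lt_of_ne' fun h => hne (Subtype.ext h))
  simp [h k (mem_supp.2 hk')] at hk

lemma cubeCoord_eq_one {z : stdSimplex ℝ (L × (Fin N → Bool))} {j : Fin N}
    (h : ∀ k ∈ supp z.1, k.2 j = true) : cubeCoord z j = 1 := by
  by_contra hne
  obtain ⟨k, hk, hk'⟩ := (cubeCoord_lt_one_iff z j).1
    ((cubeCoord z j).2.2.lt_of_ne fun h => hne (Subtype.ext h))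
  simp [h k (mem_supp.2 hk')] at hk

lemma simplexMap_fst_supported {z : stdSimplex ℝ (L × (Fin N → Bool))} {T : Set L}
    (h : ∀ k ∈ supp z.1, k.1 ∈ T) (i : L) (hi : i ∉ T) :
    (simplexMap Prod.fst z).1 i = 0 := by
  by_contra hne
  obtain ⟨k, rfl, hk'⟩ := (push_pos_iff _ z.2 i).1
    (((simplexMap Prod.fst z).2.1 i).lt_of_ne' hne)
  exact hi (h k (mem_supp.2 hk'))

lemma fst_mem_of_prismSection_pos {x : L → ℝ} {y : Fin N → I} {k : L × (Fin N → Bool)}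
    (hx : x ∈ stdSimplex ℝ L) (h : 0 < prismSection x y k) {T : Set L}
    (hT : ∀ i, i ∉ T → x i = 0) : k.1 ∈ T := by
  by_contra hne
  exact (prismSection_pos hx h).1.ne' (hT _ hne)

end Coordinates

section Restriction

variable {P : Type} [PartialOrder P] {X : Type} [TopologicalSpace X]

lemma maxSupp_simplexMap {k m : ℕ} {ι : Fin (k + 1) → Fin (m + 1)} (hι : Monotone ι)
    (x : stdSimplex ℝ (Fin (k + 1))) : maxSupp (simplexMap ι x) = ι (maxSupp x) := by
  refine maxSupp_eq _ ((push_pos_iff ι x.2 _).2 ⟨_, rfl, maxSupp_pos x⟩) fun j hj => ?_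
  obtain ⟨i, rfl, hi⟩ := (push_pos_iff ι x.2 _).1 hj
  exact hι (le_maxSupp x hi)

lemma flagStrat_simplexMap {k m : ℕ} {ι : Fin (k + 1) → Fin (m + 1)} (hι : Monotone ι)
    (J : Fin (m + 1) → P) (x : stdSimplex ℝ (Fin (k + 1))) :
    flagStrat J (simplexMap ι x) = flagStrat (J ∘ ι) x :=
  congrArg J (maxSupp_simplexMap hι x)

/-- Restriction of stratified maps along a face of the simplex. -/
noncomputable def resCMap (s : X → P) {k m : ℕ} (J : Fin (m + 1) → P)
    (ι : Fin (k + 1) → Fin (m + 1)) (hι : Monotone ι) : C(Holink s J, Holink s (J ∘ ι)) :=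
  ⟨fun f => ⟨f.1.comp (simplexMap ι), fun x => (f.2 _).trans (flagStrat_simplexMap hι J x)⟩,
    ((ContinuousMap.continuous_precomp _).comp continuous_subtype_val).subtype_mk _⟩

lemma resCMap_apply (s : X → P) {k m : ℕ} (J : Fin (m + 1) → P)
    (ι : Fin (k + 1) → Fin (m + 1)) (hι : Monotone ι) (f : Holink s J)
    (x : stdSimplex ℝ (Fin (k + 1))) : (resCMap s J ι hι f).1 x = f.1 (simplexMap ι x) := rfl

lemma continuousOn_eval {A B C : Type} [TopologicalSpace A] [TopologicalSpace B]
    [TopologicalSpace C] [LocallyCompactSpace A] {f : B → C(A, C)} {T : Set B}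
    (hf : ContinuousOn f T) : ContinuousOn (fun a : A × B => f a.2 a.1) (Prod.snd ⁻¹' T) := by
  have h : ContinuousOn (fun a : A × B => (f a.2, a.1)) (Prod.snd ⁻¹' T) :=
    (hf.comp continuousOn_snd fun a ha => ha).prodMk continuousOn_fst
  exact (ContinuousEval.continuous_eval (F := C(A, C)) (X := A) (Y := C)).comp_continuousOn h

/-- Homotopy extension: restriction of stratified maps to a face is a fibration. -/
theorem isFib_resCMap {s : X → P} (hs : DiagFibrant s) {k m : ℕ} {J : Fin (m + 1) → P}
    (hJ : Monotone J) {ι : Fin (k + 1) → Fin (m + 1)} (hι : StrictMono ι) :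
    IsFib (resCMap s J ι hι.monotone) := by
  classical
  intro n h g hh hg
  let r : Fin (m + 1) → Fin (k + 1) := Function.invFun ι
  have hr : Function.LeftInverse r ι := Function.leftInverse_invFun hι.injective
  let S : Set (stdSimplex ℝ (Fin (m + 1)) × (Fin (n + 1) → I)) := Prod.snd ⁻¹' openBox n
  let T : Set (stdSimplex ℝ (Fin (m + 1)) × (Fin (n + 1) → I)) :=
    Prod.fst ⁻¹' {x | ∀ i, i ∉ range ι → x.1 i = 0}
  have hST : ∀ a ∈ S, a ∈ T → (h a.2).1 a.1 = (g a.2).1 (simplexMap r a.1) := by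
    intro a ha ha'
    rw [← hg _ ha, resCMap_apply, simplexMap_of_supported hr ha']
  obtain ⟨F, hF, hFS, hFT⟩ := exists_glue (S := S) (T := T)
    ((isClosed_openBox n).preimage continuous_snd) ((isClosed_supported _).preimage continuous_fst)
    (fun a => (h a.2).1 a.1) (fun a => (g a.2).1 (simplexMap r a.1))
    (continuousOn_eval (f := fun y => (h y).1)
      (continuous_subtype_val.comp_continuousOn hh))
    (Continuous.continuousOn (by fun_prop)) hST
  let 𝓛 : Set (Finset (Fin (m + 1) × (Fin (n + 1) → Bool))) :=
    {ω | (∀ k ∈ ω, k.2 0 = false) ∨ (∃ (j : Fin n) (b : Bool), ∀ k ∈ ω, k.2 j.succ = b) ∨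
      ∀ k ∈ ω, k.1 ∈ range ι}
  have h𝓛 : IsLowerSet 𝓛 := by
    rintro a b hba (h | ⟨j, c, h⟩ | h)
    · exact Or.inl fun k hk => h k (hba hk)
    · exact Or.inr (Or.inl ⟨j, c, fun k hk => h k (hba hk)⟩)
    · exact Or.inr (Or.inr fun k hk => h k (hba hk))
  obtain ⟨G, hG⟩ := exists_prism_extension hs hJ h𝓛 (Q := Fin (m + 1) × (Fin n → Bool))
    (fun q => (q.1, Fin.cons true q.2)) (fun q => (q.1, Fin.cons false q.2))
    (fun q q' he => by
      have := congrFun (congrArg Prod.snd he) 0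
      simp at this)
    (fun ω hω => by
      have : ¬ ∀ k ∈ ω, k.2 0 = false := fun h => hω (Or.inl h)
      push Not at this
      obtain ⟨k, hk, hk0⟩ := this
      refine ⟨(k.1, Fin.tail k.2), ?_⟩
      have : (Fin.cons true (Fin.tail k.2) : Fin (n + 1) → Bool) = k.2 := by
        rw [← Bool.eq_true_of_not_eq_false hk0, Fin.cons_self_tail]
      rw [this]
      exact hk)
    (fun ω q hω hq hmem => hω (by
      have huv : ((q.1, Fin.cons true q.2) : Fin (m + 1) × (Fin (n + 1) → Bool)) ∈
          ω.erase (q.1, Fin.cons false q.2) := by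
        refine Finset.mem_erase.2 ⟨fun he => ?_, hq⟩
        have := congrFun (congrArg Prod.snd he) 0
        simp at this
      have hcase : ∀ p : Fin (m + 1) × (Fin (n + 1) → Bool) → Prop,
          (∀ k ∈ ω.erase (q.1, Fin.cons false q.2), p k) → p (q.1, Fin.cons false q.2) →
          ∀ k ∈ ω, p k := by
        intro p h1 h2 k hk
        by_cases hkv : k = (q.1, Fin.cons false q.2)
        · exact hkv ▸ h2
        · exact h1 k (Finset.mem_erase.2 ⟨hkv, hk⟩)
      rcases hmem with h | ⟨j, b, h⟩ | h
      · have := h _ huv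
        simp at this
      · refine Or.inr (Or.inl ⟨j, b, hcase _ h ?_⟩)
        have := h _ huv
        simpa using this
      · have := h _ huv
        exact Or.inr (Or.inr (hcase (fun k => k.1 ∈ range ι) h this))))
    (fun ω q hω hq => by
      refine Or.inl ⟨_, Finset.mem_insert_of_mem hq, fun he => ?_, rfl⟩
      have := congrFun (congrArg Prod.snd he) 0
      simp at this)
    (A := S ∪ T)
    (by
      rintro z (h | ⟨j, b, h⟩ | h)
      · exact Or.inl (Or.inl (cubeCoord_eq_zero h))
      · cases b
        exacts [Or.inl (Or.inr ⟨j, Or.inl (cubeCoord_eq_zero h)⟩),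
          Or.inl (Or.inr ⟨j, Or.inr (cubeCoord_eq_one h)⟩)]
      · exact Or.inr (simplexMap_fst_supported h))
    (by
      rintro ⟨x, y⟩ ((h | ⟨j, h | h⟩) | h)
      · exact Or.inl fun k hk => eq_false_of_prismSection_pos x.2 (mem_supp.1 hk) h
      · exact Or.inr (Or.inl ⟨j, false, fun k hk =>
          eq_false_of_prismSection_pos x.2 (mem_supp.1 hk) h⟩)
      · exact Or.inr (Or.inl ⟨j, true, fun k hk =>
          eq_true_of_prismSection_pos x.2 (mem_supp.1 hk) h⟩)
      · exact Or.inr (Or.inr fun k hk => fst_mem_of_prismSection_pos x.2 (mem_supp.1 hk) h))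
    F hF
    (by
      rintro a (ha | ha)
      · rw [hFS a ha]
        exact (h a.2).2 a.1
      · rw [hFT a ha, (g a.2).2, ← flagStrat_simplexMap hι.monotone,
          simplexMap_of_supported hr ha])
  refine ⟨G, fun y hy => Subtype.ext (ContinuousMap.ext fun x => ?_), fun y =>
    Subtype.ext (ContinuousMap.ext fun x => ?_)⟩
  · exact (hG (x, y) (Or.inl hy)).trans (hFS (x, y) hy)
  · have hx : (simplexMap ι x, y) ∈ T := simplexMap_supported ι x
    rw [resCMap_apply]
    refine ((hG _ (Or.inr hx)).trans (hFT _ hx)).trans ?_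
    change (g y).1 (simplexMap r (simplexMap ι x)) = (g y).1 x
    rw [simplexMap_leftInverse hr]

end Restriction

end SimplexExt

namespace SimplexExt

set_option linter.unusedSectionVars false

open HtpyLoc

section Spine

variable {P : Type} [PartialOrder P] {X : Type} [TopologicalSpace X]

/-- The inclusion of the initial edge. -/
def initialEdge (m : ℕ) : Fin 2 → Fin (m + 3) := Fin.cons 0 fun _ => Fin.succ 0

lemma strictMono_initialEdge (m : ℕ) : StrictMono (initialEdge m) := by
  intro i j hij
  obtain ⟨rfl, rfl⟩ : i = 0 ∧ j = 1 := by omega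
  exact Fin.succ_pos 0

lemma mem_range_initialEdge {m : ℕ} {i : Fin (m + 3)} :
    i ∈ range (initialEdge m) ↔ i ≤ Fin.succ 0 := by
  constructor
  · rintro ⟨j, rfl⟩
    exact (strictMono_initialEdge m).monotone (Fin.le_last j)
  · intro h
    rcases Fin.eq_zero_or_eq_succ i with rfl | ⟨j, rfl⟩
    · exact ⟨0, rfl⟩
    · have : j = 0 := Fin.le_zero_iff.1 (Fin.succ_le_succ_iff.1 h)
      exact ⟨1, by rw [this]; rfl⟩

variable (s : X → P)

/-- Evaluation of a stratified map at a vertex. -/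
noncomputable abbrev vertexCMap {m : ℕ} (J : Fin (m + 1) → P) (i : Fin (m + 1)) :
    C(Holink s J, Holink s (J ∘ fun _ : Fin 1 => i)) :=
  resCMap s J (fun _ => i) monotone_const

/-- Restriction of stratified maps to the initial edge. -/
noncomputable abbrev edgeCMap {m : ℕ} (J : Fin (m + 3) → P) :
    C(Holink s J, Holink s (J ∘ initialEdge m)) :=
  resCMap s J (initialEdge m) (strictMono_initialEdge m).monotone

/-- Restriction of stratified maps to the face opposite to the initial vertex. -/
noncomputable abbrev tailCMap {m : ℕ} (J : Fin (m + 2) → P) :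
    C(Holink s J, Holink s (J ∘ Fin.succ)) :=
  resCMap s J Fin.succ Fin.strictMono_succ.monotone

/-- Evaluation of a stratified map on the initial edge at the terminal vertex. -/
noncomputable abbrev edgeEndCMap {m : ℕ} (J : Fin (m + 3) → P) :
    C(Holink s (J ∘ initialEdge m), Holink s ((J ∘ Fin.succ) ∘ fun _ : Fin 1 => (0 : Fin (m + 2)))) :=
  vertexCMap s (J ∘ initialEdge m) 1

lemma vertexCMap_tailCMap {m : ℕ} (J : Fin (m + 3) → P) (f : Holink s J) :
    vertexCMap s (J ∘ Fin.succ) 0 (tailCMap s J f) = edgeEndCMap s J (edgeCMap s J f) := by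
  refine Subtype.ext (ContinuousMap.ext fun x => ?_)
  change f.1 (simplexMap _ (simplexMap _ x)) = f.1 (simplexMap _ (simplexMap _ x))
  rw [simplexMap_simplexMap, simplexMap_simplexMap]
  rfl

variable {s}

lemma exists_spine_extension (hs : DiagFibrant s) {m : ℕ} {J : Fin (m + 3) → P} (hJ : Monotone J)
    (γ : Holink s (J ∘ initialEdge m)) {n : ℕ}
    (h : (Fin n → I) → C(stdSimplex ℝ (Fin (m + 3)), X)) (hh : ContinuousOn h (cubeBoundary n))
    (hhs : ∀ y ∈ cubeBoundary n, ∀ x, s (h y x) = flagStrat J x)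
    (hhγ : ∀ y ∈ cubeBoundary n, ∀ x, h y (simplexMap (initialEdge m) x) = γ.1 x)
    (g : C(Fin n → I, Holink s (J ∘ Fin.succ)))
    (hg : ∀ y, vertexCMap s (J ∘ Fin.succ) 0 (g y) = edgeEndCMap s J γ)
    (hhg : ∀ y ∈ cubeBoundary n, ∀ x, h y (simplexMap Fin.succ x) = (g y).1 x) :
    ∃ G : C(Fin n → I, Holink s J), (∀ y ∈ cubeBoundary n, (G y).1 = h y) ∧
      (∀ y, edgeCMap s J (G y) = γ) ∧ ∀ y, tailCMap s J (G y) = g y := by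
  classical
  let r : Fin (m + 3) → Fin 2 := Function.invFun (initialEdge m)
  have hr : Function.LeftInverse r (initialEdge m) :=
    Function.leftInverse_invFun (strictMono_initialEdge m).injective
  let r' : Fin (m + 3) → Fin (m + 2) := Function.invFun Fin.succ
  have hr' : Function.LeftInverse r' Fin.succ :=
    Function.leftInverse_invFun (Fin.succ_injective _)
  let S : Set (stdSimplex ℝ (Fin (m + 3)) × (Fin n → I)) := Prod.snd ⁻¹' cubeBoundary n
  let T : Set (stdSimplex ℝ (Fin (m + 3)) × (Fin n → I)) :=
    Prod.fst ⁻¹' {x | ∀ i, i ∉ range (initialEdge m) → x.1 i = 0}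
  let T' : Set (stdSimplex ℝ (Fin (m + 3)) × (Fin n → I)) :=
    Prod.fst ⁻¹' {x | ∀ i, i ∉ range Fin.succ → x.1 i = 0}
  have hS : IsClosed S := (isClosed_cubeBoundary n).preimage continuous_snd
  have hT : IsClosed T := (isClosed_supported _).preimage continuous_fst
  have hT' : IsClosed T' := (isClosed_supported _).preimage continuous_fst
  have hTT' : ∀ a ∈ T, a ∈ T' →
      γ.1 (simplexMap r a.1) = (g a.2).1 (simplexMap r' a.1) := by
    rintro ⟨x, y⟩ ha ha'
    obtain ⟨x', rfl⟩ : ∃ x', simplexMap (fun _ : Fin 1 => (Fin.succ 0 : Fin (m + 3))) x' = x := by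
      have hl : Function.LeftInverse (fun _ => 0) (fun _ : Fin 1 => (Fin.succ 0 : Fin (m + 3))) :=
        fun i => (Fin.eq_zero i).symm
      refine ⟨_, simplexMap_of_supported hl fun k hk => ?_⟩
      by_contra hne
      have h1 : k ∈ range (initialEdge m) := by_contra fun h => hne (ha k h)
      obtain ⟨j, rfl⟩ : k ∈ range Fin.succ := by_contra fun h => hne (ha' k h)
      have : j = 0 := Fin.le_zero_iff.1 (Fin.succ_le_succ_iff.1 (mem_range_initialEdge.1 h1))
      exact hk ⟨0, by rw [this]⟩
    have h1 : simplexMap r (simplexMap (fun _ : Fin 1 => (Fin.succ 0 : Fin (m + 3))) x') =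
        simplexMap (fun _ => 1) x' := by
      rw [simplexMap_simplexMap]
      exact congrArg (fun φ => simplexMap φ x') (funext fun _ => hr 1)
    have h2 : simplexMap r' (simplexMap (fun _ : Fin 1 => (Fin.succ 0 : Fin (m + 3))) x') =
        simplexMap (fun _ => 0) x' := by
      rw [simplexMap_simplexMap]
      exact congrArg (fun φ => simplexMap φ x') (funext fun _ => hr' 0)
    change γ.1 (simplexMap r (simplexMap _ x')) = (g y).1 (simplexMap r' (simplexMap _ x'))
    rw [h1, h2]
    exact (congrArg (fun f : Holink s _ => f.1 x') (hg y)).symm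
  obtain ⟨F₁, hF₁, hF₁T, hF₁T'⟩ := exists_glue hT hT' (fun a => γ.1 (simplexMap r a.1))
    (fun a => (g a.2).1 (simplexMap r' a.1)) (Continuous.continuousOn (by fun_prop))
    (Continuous.continuousOn (by fun_prop)) hTT'
  obtain ⟨F, hF, hFS, hFT⟩ := exists_glue hS (hT.union hT')
    (fun a => h a.2 a.1) F₁ (continuousOn_eval (f := fun y => h y) hh) hF₁ (by
      rintro a ha (ha' | ha')
      · rw [hF₁T a ha', ← hhγ _ ha, simplexMap_of_supported hr ha']
      · rw [hF₁T' a ha', ← hhg _ ha, simplexMap_of_supported hr' ha'])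
  have hFT₁ : ∀ a ∈ T, F a = γ.1 (simplexMap r a.1) := fun a ha =>
    (hFT a (Or.inl ha)).trans (hF₁T a ha)
  have hFT₂ : ∀ a ∈ T', F a = (g a.2).1 (simplexMap r' a.1) := fun a ha =>
    (hFT a (Or.inr ha)).trans (hF₁T' a ha)
  let 𝓛 : Set (Finset (Fin (m + 3) × (Fin n → Bool))) :=
    {ω | (∃ (j : Fin n) (b : Bool), ∀ k ∈ ω, k.2 j = b) ∨
      (∀ k ∈ ω, k.1 ∈ range (initialEdge m)) ∨ ∀ k ∈ ω, k.1 ∈ range Fin.succ}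
  have h𝓛 : IsLowerSet 𝓛 := by
    rintro a b hba (⟨j, c, h⟩ | h | h)
    · exact Or.inl ⟨j, c, fun k hk => h k (hba hk)⟩
    · exact Or.inr (Or.inl fun k hk => h k (hba hk))
    · exact Or.inr (Or.inr fun k hk => h k (hba hk))
  obtain ⟨G, hG⟩ := exists_prism_extension hs hJ h𝓛 (Q := Fin n → Bool)
    (fun q => (0, q)) (fun q => (Fin.succ 0, q))
    (fun q q' he => ((Fin.succ_pos 0).ne (congrArg Prod.fst he)))
    (fun ω hω => by
      have : ¬ ∀ k ∈ ω, k.1 ∈ range Fin.succ := fun h => hω (Or.inr (Or.inr h))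
      push Not at this
      obtain ⟨⟨i, q⟩, hk, hk0⟩ := this
      have : i = 0 := by
        by_contra hne
        exact hk0 (Fin.exists_succ_eq.2 hne)
      exact ⟨q, this ▸ hk⟩)
    (fun ω q hω hq hmem => hω (by
      have huv : ((0, q) : Fin (m + 3) × (Fin n → Bool)) ∈ ω.erase (Fin.succ 0, q) :=
        Finset.mem_erase.2 ⟨fun he => (Fin.succ_pos 0).ne (congrArg Prod.fst he), hq⟩
      have hcase : ∀ p : Fin (m + 3) × (Fin n → Bool) → Prop,
          (∀ k ∈ ω.erase (Fin.succ 0, q), p k) → p (Fin.succ 0, q) → ∀ k ∈ ω, p k := by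
        intro p h1 h2 k hk
        by_cases hkv : k = (Fin.succ 0, q)
        · exact hkv ▸ h2
        · exact h1 k (Finset.mem_erase.2 ⟨hkv, hk⟩)
      rcases hmem with ⟨j, b, h⟩ | h | h
      · have := h _ huv
        exact Or.inl ⟨j, b, hcase (fun k => k.2 j = b) h this⟩
      · exact Or.inr (Or.inl (hcase (fun k => k.1 ∈ range (initialEdge m)) h
          (mem_range_initialEdge.2 le_rfl)))
      · obtain ⟨j, hj⟩ := h _ huv
        exact absurd hj (Fin.succ_ne_zero j)))
    (fun ω q hω hq => by
      have : ¬ ∀ k ∈ ω, k.1 ∈ range (initialEdge m) := fun h => hω (Or.inr (Or.inl h))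
      push Not at this
      obtain ⟨k, hk, hk0⟩ := this
      exact Or.inr ⟨_, Finset.mem_insert_of_mem hq, k, Finset.mem_insert_of_mem hk,
        Fin.succ_pos 0, not_le.1 fun h => hk0 (mem_range_initialEdge.2 h)⟩)
    (A := S ∪ (T ∪ T'))
    (by
      rintro z (⟨j, b, h⟩ | h | h)
      · cases b
        exacts [Or.inl ⟨j, Or.inl (cubeCoord_eq_zero h)⟩, Or.inl ⟨j, Or.inr (cubeCoord_eq_one h)⟩]
      · exact Or.inr (Or.inl (simplexMap_fst_supported h))
      · exact Or.inr (Or.inr (simplexMap_fst_supported h)))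
    (by
      rintro ⟨x, y⟩ (⟨j, h | h⟩ | h | h)
      · exact Or.inl ⟨j, false, fun k hk => eq_false_of_prismSection_pos x.2 (mem_supp.1 hk) h⟩
      · exact Or.inl ⟨j, true, fun k hk => eq_true_of_prismSection_pos x.2 (mem_supp.1 hk) h⟩
      · exact Or.inr (Or.inl fun k hk => fst_mem_of_prismSection_pos x.2 (mem_supp.1 hk) h)
      · exact Or.inr (Or.inr fun k hk => fst_mem_of_prismSection_pos x.2 (mem_supp.1 hk) h))
    F hF
    (by
      rintro a (ha | ha | ha)
      · rw [hFS a ha]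
        exact hhs _ ha a.1
      · rw [hFT₁ a ha, γ.2, ← flagStrat_simplexMap (strictMono_initialEdge m).monotone,
          simplexMap_of_supported hr ha]
      · rw [hFT₂ a ha, (g a.2).2, ← flagStrat_simplexMap Fin.strictMono_succ.monotone,
          simplexMap_of_supported hr' ha])
  refine ⟨G, fun y hy => ContinuousMap.ext fun x => ?_, fun y =>
    Subtype.ext (ContinuousMap.ext fun x => ?_), fun y =>
    Subtype.ext (ContinuousMap.ext fun x => ?_)⟩
  · exact (hG (x, y) (Or.inl hy)).trans (hFS (x, y) hy)
  · have hx : (simplexMap (initialEdge m) x, y) ∈ T := simplexMap_supported _ x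
    rw [resCMap_apply]
    refine ((hG _ (Or.inr (Or.inl hx))).trans (hFT₁ _ hx)).trans ?_
    change γ.1 (simplexMap r (simplexMap _ x)) = γ.1 x
    rw [simplexMap_leftInverse hr]
  · have hx : (simplexMap Fin.succ x, y) ∈ T' := simplexMap_supported _ x
    rw [resCMap_apply]
    refine ((hG _ (Or.inr (Or.inr hx))).trans (hFT₂ _ hx)).trans ?_
    change (g y).1 (simplexMap r' (simplexMap _ x)) = (g y).1 x
    rw [simplexMap_leftInverse hr']

/-- A stratified map on a simplex is determined, up to a contractible choice, by its restrictions
to the initial edge and the face opposite to the initial vertex. -/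
theorem isAcyclicFib_fiberMap_tailCMap (hs : DiagFibrant s) {m : ℕ} {J : Fin (m + 3) → P}
    (hJ : Monotone J) (γ : Holink s (J ∘ initialEdge m)) :
    IsAcyclicFib (fiberMap (p := edgeCMap s J) (p' := vertexCMap s (J ∘ Fin.succ) 0)
      (vertexCMap_tailCMap s J) γ) := by
  constructor
  · rintro ⟨g, hg⟩
    let x₀ : stdSimplex ℝ (Fin 2) := ⟨_, single_mem_stdSimplex ℝ 0⟩
    obtain ⟨G, -, hG, hG'⟩ := exists_spine_extension hs hJ γ (n := 0)
      (fun _ => ContinuousMap.const _ (γ.1 x₀)) continuousOn_const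
      (fun y ⟨j, _⟩ => j.elim0) (fun y ⟨j, _⟩ => j.elim0) (ContinuousMap.const _ g)
      (fun _ => hg) (fun y ⟨j, _⟩ => j.elim0)
    exact ⟨⟨G 0, hG 0⟩, Subtype.ext (hG' 0)⟩
  · intro n h g hh hg
    obtain ⟨G, h1, h2, h3⟩ := exists_spine_extension hs hJ γ (fun y => (h y).1.1)
      (continuous_subtype_val.comp_continuousOn (continuous_subtype_val.comp_continuousOn hh))
      (fun y _ x => (h y).1.2 x)
      (fun y _ x => congrArg (fun f : Holink s _ => f.1 x) (h y).2)
      ⟨fun y => (g y).1, continuous_subtype_val.comp g.continuous⟩ (fun y => (g y).2)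
      (fun y hy x => congrArg (fun f => f.1.1 x) (hg y hy))
    exact ⟨⟨fun y => ⟨G y, h2 y⟩, G.continuous.subtype_mk _⟩,
      fun y hy => Subtype.ext (Subtype.ext (h1 y hy)), fun y => Subtype.ext (h3 y)⟩

end Spine

end SimplexExt

namespace HtpyLoc

section Vertex

variable {P : Type} {X Y : Type} [TopologicalSpace X] [TopologicalSpace Y]

/-- The point of the standard `0`-simplex. -/
noncomputable def simplexPt : stdSimplex ℝ (Fin 1) := ⟨_, single_mem_stdSimplex ℝ 0⟩

lemma eq_simplexPt (x : stdSimplex ℝ (Fin 1)) : x = simplexPt := Subsingleton.elim _ _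

/-- The homotopy link of a flag of length one is a stratum. -/
noncomputable def holinkHomeoStratum (s : X → P) (J : Fin 1 → P) :
    Holink s J ≃ₜ {x : X // s x = J 0} where
  toFun f := ⟨f.1 simplexPt, (f.2 _).trans (congrArg J (Subsingleton.elim _ _))⟩
  invFun x := ⟨ContinuousMap.const _ x.1, fun _ => x.2.trans (congrArg J (Subsingleton.elim _ _))⟩
  left_inv f := Subtype.ext (ContinuousMap.ext fun x => by rw [eq_simplexPt x]; rfl)
  right_inv x := rfl
  continuous_toFun :=
    ((continuous_eval_const simplexPt).comp continuous_subtype_val).subtype_mk _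
  continuous_invFun := (ContinuousMap.continuous_const'.comp continuous_subtype_val).subtype_mk _

lemma isWeakHomotopyEquiv_holinkCMap_iff (sX : X → P) (sY : Y → P) (w : C(X, Y))
    (hw : ∀ x, sY (w x) = sX x) (J : Fin 1 → P) :
    IsWeakHomotopyEquiv (holinkCMap sX sY w hw J) ↔
      IsWeakHomotopyEquiv (stratumCMap sX sY w hw (J 0)) :=
  isWeakHomotopyEquiv_congr _ _ (holinkHomeoStratum sX J) (holinkHomeoStratum sY J) fun _ => rfl

end Vertex

section Cone

/-- The simplex as a cone on the face opposite to the initial vertex. -/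
noncomputable def coneMap (m : ℕ) :
    C(stdSimplex ℝ (Fin (m + 1)) × I, stdSimplex ℝ (Fin (m + 2))) where
  toFun a := ⟨Fin.cons (1 - (a.2 : ℝ)) fun i => a.2 * a.1.1 i, by
    constructor
    · intro i
      refine Fin.cases ?_ (fun i => ?_) i
      · simpa using a.2.2.2
      · simpa using mul_nonneg a.2.2.1 (a.1.2.1 i)
    · rw [Fin.sum_univ_succ]
      simp only [Fin.cons_zero, Fin.cons_succ, ← Finset.mul_sum]
      rw [show ∑ i, a.1.1 i = 1 from a.1.2.2]
      ring⟩
  continuous_toFun := by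
    refine Continuous.subtype_mk (continuous_pi fun i => ?_) _
    refine Fin.cases ?_ (fun i => ?_) i
    · simp only [Fin.cons_zero]
      fun_prop
    · simp only [Fin.cons_succ]
      exact (continuous_subtype_val.comp continuous_snd).mul
        ((continuous_apply i).comp (continuous_subtype_val.comp continuous_fst))

variable {m : ℕ}

lemma coneMap_surjective : Function.Surjective (coneMap m) := by
  intro x
  have hsum : x.1 0 + ∑ i : Fin (m + 1), x.1 i.succ = 1 := by
    rw [← Fin.sum_univ_succ]; exact x.2.2
  have hnn : ∀ i, 0 ≤ x.1 i := x.2.1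
  have hle : x.1 0 ≤ 1 := by
    have := Finset.sum_nonneg fun (i : Fin (m + 1)) (_ : i ∈ Finset.univ) => hnn i.succ
    linarith
  by_cases h : x.1 0 = 1
  · refine ⟨(⟨_, single_mem_stdSimplex ℝ 0⟩, 0), Subtype.ext (funext fun i => ?_)⟩
    have h0 : ∑ i : Fin (m + 1), x.1 i.succ = 0 := by linarith
    refine Fin.cases ?_ (fun i => ?_) i
    · simp [coneMap, h]
    · have := (Finset.sum_eq_zero_iff_of_nonneg fun (i : Fin (m + 1)) _ => hnn i.succ).1 h0 i
        (Finset.mem_univ i)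
      simp [coneMap, this]
  · have hpos : 0 < 1 - x.1 0 := by
      have := lt_of_le_of_ne hle h
      linarith
    refine ⟨(⟨fun i => x.1 i.succ / (1 - x.1 0), fun i => div_nonneg (hnn _) hpos.le, ?_⟩,
      ⟨1 - x.1 0, hpos.le, by linarith [hnn 0]⟩), Subtype.ext (funext fun i => ?_)⟩
    · rw [← Finset.sum_div, div_eq_one_iff_eq hpos.ne']
      linarith
    · refine Fin.cases ?_ (fun i => ?_) i
      · simp [coneMap]
      · simp only [coneMap, ContinuousMap.coe_mk, Fin.cons_succ]
        rw [mul_div_cancel₀ _ hpos.ne']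

lemma maxSupp_coneMap_zero (y : stdSimplex ℝ (Fin (m + 1))) : maxSupp (coneMap m (y, 0)) = 0 := by
  refine maxSupp_eq _ (by simp [coneMap]) fun j => ?_
  refine Fin.cases (fun _ => le_rfl) (fun j hj => ?_) j
  simp [coneMap] at hj

lemma maxSupp_coneMap (y : stdSimplex ℝ (Fin (m + 1))) {t : I} (ht : t ≠ 0) :
    maxSupp (coneMap m (y, t)) = (maxSupp y).succ := by
  have ht' : 0 < (t : ℝ) := t.2.1.lt_of_ne' fun h => ht (Subtype.ext h)
  refine maxSupp_eq _ ?_ fun j => ?_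
  · simpa [coneMap] using mul_pos ht' (maxSupp_pos y)
  · refine Fin.cases (fun _ => Fin.zero_le _) (fun j hj => ?_) j
    refine Fin.succ_le_succ_iff.2 (le_maxSupp y ?_)
    simp only [coneMap, ContinuousMap.coe_mk, Fin.cons_succ] at hj
    exact pos_of_mul_pos_right hj ht'.le

lemma coneMap_zero_eq (y : stdSimplex ℝ (Fin (m + 1))) (x : stdSimplex ℝ (Fin 1)) :
    coneMap m (y, 0) = SimplexExt.simplexMap (fun _ : Fin 1 => (0 : Fin (m + 2))) x := by
  have hx : x.1 0 = 1 := by simpa using x.2.2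
  refine Subtype.ext (funext fun i => ?_)
  refine Fin.cases ?_ (fun i => ?_) i
  · simp [coneMap, SimplexExt.simplexMap, SimplexExt.push, hx]
  · simp [coneMap, SimplexExt.simplexMap, SimplexExt.push, (Fin.succ_ne_zero i).symm]

lemma isQuotientMap_prodMap_coneMap (H : Type) [TopologicalSpace H] :
    Topology.IsQuotientMap ((ContinuousMap.id H).prodMap (coneMap m)) := by
  have h1 : IsProperMap (coneMap m) := (coneMap m).continuous.isProperMap
  have h2 : IsProperMap (Prod.map (id : H → H) (coneMap m)) := isProperMap_id.prodMap h1
  exact h2.isClosedMap.isQuotientMap h2.continuous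
    (Function.surjective_id.prodMap coneMap_surjective)

end Cone

end HtpyLoc

namespace HtpyLoc

set_option linter.unusedSectionVars false

open SimplexExt

lemma strictMono_of_vertex {α : Type*} [Preorder α] (f : Fin 1 → α) : StrictMono f :=
  Subsingleton.strictMono f

section LocalLink

variable {P : Type} [PartialOrder P] {X : Type} [TopologicalSpace X] {s : X → P} {m : ℕ}
  {J : Fin (m + 2) → P}

/-- The flag over the strictly larger elements obtained by removing the initial element. -/
def tailFlag (hJ : StrictMono J) : Fin (m + 1) → {q : P // J 0 < q} :=
  fun i => ⟨J i.succ, hJ (Fin.succ_pos i)⟩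

lemma strictMono_tailFlag (hJ : StrictMono J) : StrictMono (tailFlag hJ) :=
  fun _ _ h => hJ (Fin.succ_lt_succ_iff.2 h)

/-- The fiber of the evaluation at the initial vertex. -/
abbrev VertexFiber (s : X → P) (J : Fin (m + 2) → P) (γ : Holink s (J ∘ fun _ : Fin 1 => 0)) :=
  {f : Holink s J // vertexCMap s J 0 f = γ}

variable {γ : Holink s (J ∘ fun _ : Fin 1 => 0)}

lemma VertexFiber.apply_coneMap_zero (f : VertexFiber s J γ) (y : stdSimplex ℝ (Fin (m + 1))) :
    f.1.1 (coneMap m (y, 0)) = γ.1 simplexPt := by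
  rw [coneMap_zero_eq y simplexPt]
  exact congrArg (fun g : Holink s _ => g.1 simplexPt) f.2

lemma strat_coneMap_zero (f : Holink s J) (y : stdSimplex ℝ (Fin (m + 1))) :
    s (f.1 (coneMap m (y, 0))) = J 0 :=
  (f.2 _).trans (congrArg J (maxSupp_coneMap_zero y))

lemma strat_coneMap (f : Holink s J) (y : stdSimplex ℝ (Fin (m + 1))) {t : I} (ht : t ≠ 0) :
    s (f.1 (coneMap m (y, t))) = J (maxSupp y).succ :=
  (f.2 _).trans (congrArg J (maxSupp_coneMap y ht))

/-- Restriction of stratified maps to the segments joining the initial vertex to the opposite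
face. -/
noncomputable def toExitPath (s : X → P) (J : Fin (m + 2) → P) :
    C(Holink s J × stdSimplex ℝ (Fin (m + 1)), C(I, X)) :=
  ContinuousMap.curry ⟨fun a => a.1.1.1 (coneMap m (a.1.2, a.2)), by fun_prop⟩

/-- A stratified map on the simplex with prescribed initial vertex gives a family of exit paths. -/
noncomputable def toLocalHolink (hJ : StrictMono J) (γ : Holink s (J ∘ fun _ : Fin 1 => 0)) :
    C(VertexFiber s J γ × stdSimplex ℝ (Fin (m + 1)), LocalHolink s (J 0) (γ.1 simplexPt)) where
  toFun a := ⟨⟨toExitPath s J (a.1.1, a.2), strat_coneMap_zero a.1.1 a.2,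
    fun t ht => by
      change J 0 < s (a.1.1.1 (coneMap m (a.2, t)))
      exact (hJ (Fin.succ_pos _)).trans_eq (strat_coneMap a.1.1 a.2 ht).symm,
    fun t t' ht ht' => (strat_coneMap a.1.1 a.2 ht).trans (strat_coneMap a.1.1 a.2 ht').symm⟩,
    a.1.apply_coneMap_zero a.2⟩
  continuous_toFun := by
    refine Continuous.subtype_mk (Continuous.subtype_mk ?_ _) _
    exact (toExitPath s J).continuous.comp
      ((continuous_subtype_val.comp continuous_fst).prodMk continuous_snd)

/-- Evaluation of a stratified family of exit paths. -/
def localHolinkEval (hJ : StrictMono J) (x : X) :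
    C(Holink (localHolinkStrat s (J 0) x) (tailFlag hJ) × stdSimplex ℝ (Fin (m + 1)) × I, X) :=
  ⟨fun a => (a.1.1 a.2.1).1.1 a.2.2, by fun_prop⟩

lemma factorsThrough_localHolinkEval (hJ : StrictMono J) (x : X) :
    Function.FactorsThrough (localHolinkEval (s := s) hJ x)
      ((ContinuousMap.id _).prodMap (coneMap m)) := by
  rintro ⟨φ, y, t⟩ ⟨φ', y', t'⟩ h
  obtain rfl : φ = φ' := congrArg Prod.fst h
  have h' : coneMap m (y, t) = coneMap m (y', t') := congrArg Prod.snd h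
  have h0 : (t : ℝ) = t' := by
    have := congrArg (fun z => z.1 0) h'
    simpa [coneMap] using this
  obtain rfl : t = t' := Subtype.ext h0
  by_cases ht : t = 0
  · subst ht
    exact ((φ.1 y).2).trans ((φ.1 y').2).symm
  · have ht' : (t : ℝ) ≠ 0 := fun h => ht (Subtype.ext h)
    obtain rfl : y = y' := by
      refine Subtype.ext (funext fun i => mul_left_cancel₀ ht' ?_)
      have := congrArg (fun z => z.1 i.succ) h'
      simpa [coneMap] using this
    rfl

/-- The map adjoint to a stratified family of exit paths. -/
noncomputable def ofLocalHolink (hJ : StrictMono J) (x : X) :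
    C(Holink (localHolinkStrat s (J 0) x) (tailFlag hJ) × stdSimplex ℝ (Fin (m + 2)), X) :=
  (isQuotientMap_prodMap_coneMap _).lift _ (factorsThrough_localHolinkEval hJ x)

lemma ofLocalHolink_apply (hJ : StrictMono J) (x : X)
    (φ : Holink (localHolinkStrat s (J 0) x) (tailFlag hJ)) (y : stdSimplex ℝ (Fin (m + 1)))
    (t : I) : ofLocalHolink hJ x (φ, coneMap m (y, t)) = (φ.1 y).1.1 t :=
  DFunLike.congr_fun ((isQuotientMap_prodMap_coneMap _).lift_comp _
    (factorsThrough_localHolinkEval hJ x)) (φ, (y, t))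

lemma strat_ofLocalHolink (hJ : StrictMono J) (x : X)
    (φ : Holink (localHolinkStrat s (J 0) x) (tailFlag hJ)) (z : stdSimplex ℝ (Fin (m + 2))) :
    s (ofLocalHolink hJ x (φ, z)) = flagStrat J z := by
  obtain ⟨⟨y, t⟩, rfl⟩ := coneMap_surjective z
  rw [ofLocalHolink_apply]
  by_cases ht : t = 0
  · subst ht
    exact (φ.1 y).1.2.1.trans (congrArg J (maxSupp_coneMap_zero y)).symm
  · refine ((φ.1 y).1.2.2.2 t 1 ht I_one_ne_zero).trans ?_
    exact (congrArg Subtype.val (φ.2 y)).trans (congrArg J (maxSupp_coneMap y ht)).symm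

/-- The fiber of the evaluation at the initial vertex is the homotopy link of a local homotopy
link. -/
noncomputable def vertexFiberHomeo (hJ : StrictMono J) (γ : Holink s (J ∘ fun _ : Fin 1 => 0)) :
    VertexFiber s J γ ≃ₜ Holink (localHolinkStrat s (J 0) (γ.1 simplexPt)) (tailFlag hJ) where
  toFun f := ⟨(toLocalHolink hJ γ).curry f, fun y => Subtype.ext (strat_coneMap f.1 y I_one_ne_zero)⟩
  invFun φ := ⟨⟨(ofLocalHolink hJ _).curry φ, strat_ofLocalHolink hJ _ φ⟩,
    Subtype.ext (ContinuousMap.ext fun x => by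
      change ofLocalHolink hJ _ (φ, simplexMap _ x) = γ.1 x
      obtain rfl := eq_simplexPt x
      let y : stdSimplex ℝ (Fin (m + 1)) := ⟨_, single_mem_stdSimplex ℝ 0⟩
      rw [← coneMap_zero_eq y, ofLocalHolink_apply]
      exact (φ.1 y).2)⟩
  left_inv f := Subtype.ext (Subtype.ext (ContinuousMap.ext fun z => by
    obtain ⟨⟨y, t⟩, rfl⟩ := coneMap_surjective z
    exact ofLocalHolink_apply hJ _ _ y t))
  right_inv φ := Subtype.ext (ContinuousMap.ext fun y => Subtype.ext (Subtype.ext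
    (ContinuousMap.ext fun t => ofLocalHolink_apply hJ _ φ y t)))
  continuous_toFun := (toLocalHolink hJ γ).curry.continuous.subtype_mk _
  continuous_invFun := ((ofLocalHolink hJ _).curry.continuous.subtype_mk _).subtype_mk _

end LocalLink

section Comparison

variable {P : Type} [PartialOrder P] {X Y : Type} [TopologicalSpace X] [TopologicalSpace Y]
  {sX : X → P} {sY : Y → P} (w : C(X, Y)) (hw : ∀ x, sY (w x) = sX x)

lemma resCMap_holinkCMap {k m : ℕ} (J : Fin (m + 1) → P) (ι : Fin (k + 1) → Fin (m + 1))
    (hι : Monotone ι) (f : Holink sX J) :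
    resCMap sY J ι hι (holinkCMap sX sY w hw J f) =
      holinkCMap sX sY w hw (J ∘ ι) (resCMap sX J ι hι f) := rfl

lemma isWeakHomotopyEquiv_vertexFiber_iff {m : ℕ} {J : Fin (m + 2) → P} (hJ : StrictMono J)
    (γ : Holink sX (J ∘ fun _ : Fin 1 => 0)) :
    IsWeakHomotopyEquiv (fiberMap (resCMap_holinkCMap w hw J (fun _ : Fin 1 => 0) monotone_const)
      γ) ↔
    IsWeakHomotopyEquiv (holinkCMap (localHolinkStrat sX (J 0) (γ.1 simplexPt))
      (localHolinkStrat sY (J 0) (w (γ.1 simplexPt)))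
      (localHolinkCMap w hw (J 0) (γ.1 simplexPt))
      (localHolinkCMap_strat w hw (J 0) (γ.1 simplexPt)) (tailFlag hJ)) :=
  isWeakHomotopyEquiv_congr _ _ (vertexFiberHomeo hJ γ)
    (vertexFiberHomeo hJ (holinkCMap sX sY w hw _ γ)) fun _ => rfl

variable (hfibX : DiagFibrant sX) (hfibY : DiagFibrant sY)
include hfibX hfibY

lemma isWeakHomotopyEquiv_holinkCMap_of_localHolinks {m : ℕ} {J : Fin (m + 2) → P}
    (hJ : StrictMono J) (h₀ : IsWeakHomotopyEquiv (stratumCMap sX sY w hw (J 0)))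
    (h : ∀ x, sX x = J 0 → IsWeakHomotopyEquiv (holinkCMap (localHolinkStrat sX (J 0) x)
      (localHolinkStrat sY (J 0) (w x)) (localHolinkCMap w hw (J 0) x)
      (localHolinkCMap_strat w hw (J 0) x) (tailFlag hJ))) :
    IsWeakHomotopyEquiv (holinkCMap sX sY w hw J) := by
  refine isWeakHomotopyEquiv_of_fiberMap
    (resCMap_holinkCMap w hw J (fun _ : Fin 1 => 0) monotone_const)
    (isFib_resCMap hfibX hJ.monotone (strictMono_of_vertex _))
    (isFib_resCMap hfibY hJ.monotone (strictMono_of_vertex _)) (fun γ => ?_)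
    ((isWeakHomotopyEquiv_holinkCMap_iff sX sY w hw (J ∘ fun _ : Fin 1 => 0)).2 h₀)
  exact (isWeakHomotopyEquiv_vertexFiber_iff w hw hJ γ).2 (h _ (γ.2 simplexPt))

lemma isWeakHomotopyEquiv_localHolinks {m : ℕ} {J : Fin (m + 2) → P}
    (hJ : StrictMono J) (h₀ : IsWeakHomotopyEquiv (stratumCMap sX sY w hw (J 0)))
    (h : IsWeakHomotopyEquiv (holinkCMap sX sY w hw J)) (x : X) (hx : sX x = J 0) :
    IsWeakHomotopyEquiv (holinkCMap (localHolinkStrat sX (J 0) x)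
      (localHolinkStrat sY (J 0) (w x)) (localHolinkCMap w hw (J 0) x)
      (localHolinkCMap_strat w hw (J 0) x) (tailFlag hJ)) :=
  (isWeakHomotopyEquiv_vertexFiber_iff w hw hJ ⟨ContinuousMap.const _ x, fun _ => hx⟩).1
    (isWeakHomotopyEquiv_fiberMap _
      (isFib_resCMap hfibX hJ.monotone (strictMono_of_vertex _))
      (isFib_resCMap hfibY hJ.monotone (strictMono_of_vertex _)) h
      ((isWeakHomotopyEquiv_holinkCMap_iff sX sY w hw (J ∘ fun _ : Fin 1 => 0)).2 h₀) _)

lemma isWeakHomotopyEquiv_holinkCMap_of_spine {m : ℕ} {J : Fin (m + 3) → P}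
    (hJ : StrictMono J)
    (h₁ : IsWeakHomotopyEquiv (holinkCMap sX sY w hw (J ∘ initialEdge m)))
    (h₂ : IsWeakHomotopyEquiv (holinkCMap sX sY w hw (J ∘ Fin.succ)))
    (h₃ : IsWeakHomotopyEquiv (stratumCMap sX sY w hw (J (Fin.succ 0)))) :
    IsWeakHomotopyEquiv (holinkCMap sX sY w hw J) := by
  have hJ' : Monotone (J ∘ Fin.succ) := hJ.monotone.comp Fin.strictMono_succ.monotone
  refine isWeakHomotopyEquiv_of_fiberMap (resCMap_holinkCMap w hw J (initialEdge m) _)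
    (isFib_resCMap hfibX hJ.monotone (strictMono_initialEdge m))
    (isFib_resCMap hfibY hJ.monotone (strictMono_initialEdge m)) (fun γ => ?_) h₁
  exact IsWeakHomotopyEquiv.of_square _
    (fiberMap (resCMap_holinkCMap w hw (J ∘ Fin.succ) (fun _ : Fin 1 => 0) monotone_const)
      (edgeEndCMap sX J γ)) _ _ (fun _ => rfl)
    (isAcyclicFib_fiberMap_tailCMap hfibX hJ.monotone γ).isWeakHomotopyEquiv
    (isAcyclicFib_fiberMap_tailCMap hfibY hJ.monotone (holinkCMap sX sY w hw _ γ)).isWeakHomotopyEquiv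
    (isWeakHomotopyEquiv_fiberMap _ (isFib_resCMap hfibX hJ' (strictMono_of_vertex _))
      (isFib_resCMap hfibY hJ' (strictMono_of_vertex _)) h₂
      ((isWeakHomotopyEquiv_holinkCMap_iff sX sY w hw
        ((J ∘ Fin.succ) ∘ fun _ : Fin 1 => 0)).2 h₃) _)

lemma isDiagEquiv_of_strata_of_localStrata
    (h : ∀ p : P, IsWeakHomotopyEquiv (stratumCMap sX sY w hw p) ∧
      ∀ x : X, sX x = p → ∀ q : {q : P // p < q}, IsWeakHomotopyEquiv
        (stratumCMap (localHolinkStrat sX p x) (localHolinkStrat sY p (w x))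
          (localHolinkCMap w hw p x) (localHolinkCMap_strat w hw p x) q)) :
    IsDiagEquiv sX sY w hw := by
  have h0 : ∀ J : Fin 1 → P, IsWeakHomotopyEquiv (holinkCMap sX sY w hw J) := fun J =>
    (isWeakHomotopyEquiv_holinkCMap_iff sX sY w hw J).2 (h _).1
  have h1 : ∀ J : Fin 2 → P, StrictMono J → IsWeakHomotopyEquiv (holinkCMap sX sY w hw J) :=
    fun J hJ => isWeakHomotopyEquiv_holinkCMap_of_localHolinks w hw hfibX hfibY hJ (h _).1
      fun x hx => (isWeakHomotopyEquiv_holinkCMap_iff _ _ _ _ _).2 ((h _).2 x hx _)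
  intro m
  induction m with
  | zero => exact fun J _ => h0 J
  | succ m ih =>
    cases m with
    | zero => exact h1
    | succ m =>
      exact fun J hJ => isWeakHomotopyEquiv_holinkCMap_of_spine w hw hfibX hfibY hJ
        (h1 _ (hJ.comp (strictMono_initialEdge m))) (ih _ (hJ.comp Fin.strictMono_succ)) (h _).1

lemma isDiagEquiv_iff_localHolinks :
    IsDiagEquiv sX sY w hw ↔ ∀ p : P, IsWeakHomotopyEquiv (stratumCMap sX sY w hw p) ∧
      ∀ x : X, sX x = p → IsDiagEquiv (localHolinkStrat sX p x) (localHolinkStrat sY p (w x))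
        (localHolinkCMap w hw p x) (localHolinkCMap_strat w hw p x) := by
  constructor
  · intro h p
    have h0 : ∀ p, IsWeakHomotopyEquiv (stratumCMap sX sY w hw p) := fun p =>
      (isWeakHomotopyEquiv_holinkCMap_iff sX sY w hw fun _ => p).1
        (h 0 _ (strictMono_of_vertex _))
    refine ⟨h0 p, fun x hx m J' hJ' => ?_⟩
    have hJ : StrictMono (Fin.cons p fun i => (J' i).1 : Fin (m + 2) → P) := by
      refine Fin.strictMono_iff_lt_succ.2 fun i => ?_
      cases i using Fin.cases with
      | zero => exact (J' 0).2
      | succ i => exact hJ' i.castSucc_lt_succ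
    exact isWeakHomotopyEquiv_localHolinks w hw hfibX hfibY hJ (h0 p) (h _ _ hJ) x hx
  · intro h m
    cases m with
    | zero =>
      exact fun J _ => (isWeakHomotopyEquiv_holinkCMap_iff sX sY w hw J).2 (h _).1
    | succ m =>
      exact fun J hJ => isWeakHomotopyEquiv_holinkCMap_of_localHolinks w hw hfibX hfibY hJ (h _).1
        fun x hx => (h _).2 x hx _ _ (strictMono_tailFlag hJ)

end Comparison

end HtpyLoc

/-- **Local characterization of diagrammatic equivalences.** For a stratified map
`w : X → Y` between diagrammatically fibrant stratified spaces over `P`, `w` is a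
diagrammatic equivalence iff each restriction `w_p : X_p → Y_p` is a weak homotopy
equivalence and each induced map of local homotopy links
`Hol^s_p(X)_x → Hol^s_p(Y)_{w(x)}` is a diagrammatic equivalence over `P_{>p}`.
If moreover `X` and `Y` are categorically fibrant, these conditions are further
equivalent to: each `w_p` is a weak homotopy equivalence and each induced map of
local homotopy links restricts to a weak homotopy equivalence on each stratum. -/
theorem diagEquiv_iff_strata_and_localHolinks {P : Type} [PartialOrder P]
    {X Y : Type} [TopologicalSpace X] [TopologicalSpace Y]
    (sX : X → P) (sY : Y → P) (hsX : AlexContinuous sX) (hsY : AlexContinuous sY)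
    (hfibX : DiagFibrant sX) (hfibY : DiagFibrant sY)
    (w : C(X, Y)) (hw : ∀ x, sY (w x) = sX x) :
    (IsDiagEquiv sX sY w hw ↔
      ∀ p : P,
        IsWeakHomotopyEquiv (stratumCMap sX sY w hw p) ∧
        ∀ x : X, sX x = p →
          IsDiagEquiv (localHolinkStrat sX p x) (localHolinkStrat sY p (w x))
            (localHolinkCMap w hw p x) (localHolinkCMap_strat w hw p x)) ∧
    (CatFibrant sX → CatFibrant sY →
      (IsDiagEquiv sX sY w hw ↔
        ∀ p : P,
          IsWeakHomotopyEquiv (stratumCMap sX sY w hw p) ∧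
          ∀ x : X, sX x = p → ∀ q : {q : P // p < q},
            IsWeakHomotopyEquiv
              (stratumCMap (localHolinkStrat sX p x) (localHolinkStrat sY p (w x))
                (localHolinkCMap w hw p x) (localHolinkCMap_strat w hw p x) q))) := by
  refine ⟨HtpyLoc.isDiagEquiv_iff_localHolinks w hw hfibX hfibY, fun _ _ => ⟨fun h p => ?_,
    HtpyLoc.isDiagEquiv_of_strata_of_localStrata w hw hfibX hfibY⟩⟩
  obtain ⟨h₁, h₂⟩ := (HtpyLoc.isDiagEquiv_iff_localHolinks w hw hfibX hfibY).1 h p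
  exact ⟨h₁, fun x hx q => (HtpyLoc.isWeakHomotopyEquiv_holinkCMap_iff _ _ _ _
    (fun _ : Fin 1 => q)).1 (h₂ x hx 0 _ (HtpyLoc.strictMono_of_vertex _))⟩
end

section
/- Let X be a diagrammatically fibrant stratified space over a poset P, let p ∈ P, x ∈ X_p, and let N ⊆ X be a neighborhood of x equipped with the induced stratification. Then the inclusion of local homotopy links Hol^s_p(N)_x → Hol^s_p(X)_x is a diagrammatic equivalence of stratified spaces over P_{>p}. -/
open Set unitInterval

section CompressionCriterion

/-- The cube can be pushed outwards onto itself, together with a scale that is `1` near the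
start and on the boundary, and equals `ε` at the end wherever the boundary has not been
reached. -/
lemma exists_cube_collar (n : ℕ) (ε : Ioc (0 : ℝ) 1) :
    ∃ (F : C(I × (Fin n → I), Fin n → I)) (G : C(I × (Fin n → I), Ioc (0 : ℝ) 1)),
      (∀ y, F (0, y) = y) ∧ (∀ y, G (0, y) = 1) ∧
      (∀ u, ∀ y ∈ cubeBoundary n, F (u, y) ∈ cubeBoundary n ∧ G (u, y) = 1) ∧
      ∀ y, G (1, y) = ε ∨ F (1, y) ∈ cubeBoundary n := by
  let w : (Fin n → I) → ℝ := fun y => ∏ i, min 1 (4 * min (y i : ℝ) (1 - y i))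
  have hw : Continuous w := by fun_prop
  have hfac (y : Fin n → I) (i : Fin n) : 0 ≤ min 1 (4 * min (y i : ℝ) (1 - y i)) :=
    le_min zero_le_one (mul_nonneg (by norm_num) (le_min (y i).2.1 (sub_nonneg.2 (y i).2.2)))
  have hw0 (y) : 0 ≤ w y := Finset.prod_nonneg fun i _ => hfac y i
  have hw1 (y) : w y ≤ 1 := Finset.prod_le_one (fun i _ => hfac y i) fun i _ => min_le_left _ _
  have hwb : ∀ y ∈ cubeBoundary n, w y = 0 := by
    rintro y ⟨i, hi | hi⟩ <;> exact Finset.prod_eq_zero (Finset.mem_univ i) (by simp [hi])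
  have hε0 := ε.2.1
  have hε1 := ε.2.2
  let F : C(I × (Fin n → I), Fin n → I) :=
    ⟨fun z i => projIcc 0 1 zero_le_one ((1 + z.1) * z.2 i - z.1 / 2 : ℝ), by fun_prop⟩
  let G : C(I × (Fin n → I), Ioc (0 : ℝ) 1) :=
    ⟨fun z => ⟨1 - z.1 * ((1 - ε) * w z.2), by
      have h1 : (1 - ε) * w z.2 ≤ 1 - ε := mul_le_of_le_one_right (by linarith) (hw1 _)
      have h0 : 0 ≤ (1 - ε) * w z.2 := mul_nonneg (by linarith) (hw0 _)
      have h2 := mul_le_of_le_one_left h0 z.1.2.2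
      have h3 := mul_nonneg z.1.2.1 h0
      constructor <;> linarith⟩, by fun_prop⟩
  refine ⟨F, G, fun y => ?_, fun y => ?_, fun u y hy => ⟨?_, ?_⟩, fun y => ?_⟩
  · ext i
    simp [F]
  · simp [G]
  · obtain ⟨i, hi | hi⟩ := hy
    · refine ⟨i, Or.inl (projIcc_of_le_left zero_le_one ?_)⟩
      have := u.2.1
      simp only [hi, Icc.coe_zero]
      linarith
    · refine ⟨i, Or.inr (projIcc_of_right_le zero_le_one ?_)⟩
      have := u.2.1
      simp only [hi, Icc.coe_one]
      linarith
  · simp [G, hwb y hy]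
  · by_cases h : ∀ i, (1 / 4 : ℝ) ≤ y i ∧ (y i : ℝ) ≤ 3 / 4
    · left
      have : w y = 1 := Finset.prod_eq_one fun i _ => by
        have : (1 / 4 : ℝ) ≤ min (y i : ℝ) (1 - y i) := le_min (h i).1 (by linarith [(h i).2])
        exact min_eq_left (by linarith)
      simp [G, this]
    · right
      simp only [not_forall, not_and_or, not_le] at h
      obtain ⟨i, hi | hi⟩ := h
      · refine ⟨i, Or.inl (projIcc_of_le_left zero_le_one ?_)⟩
        simp only [Icc.coe_one]
        linarith
      · refine ⟨i, Or.inr (projIcc_of_right_le zero_le_one ?_)⟩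
        simp only [Icc.coe_one]
        linarith

variable {A Y : Type*} [TopologicalSpace A] [TopologicalSpace Y]

/-- A continuous map with values in the range of an embedding lifts. -/
lemma Topology.IsEmbedding.exists_continuousMap_lift {j : C(A, Y)} (hj : IsEmbedding j)
    {Z : Type*} [TopologicalSpace Z] (f : C(Z, Y)) (hf : ∀ z, f z ∈ range j) :
    ∃ g : C(Z, A), ∀ z, j (g z) = f z := by
  choose g hg using hf
  exact ⟨⟨g, hj.continuous_iff.2 (by simpa [Function.comp_def, hg] using f.continuous)⟩, hg⟩

/-- A homotopy with values in the range of an embedding lifts. -/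
lemma Topology.IsEmbedding.homotopicRel_of_comp {j : C(A, Y)} (hj : IsEmbedding j)
    {Z : Type*} [TopologicalSpace Z] {B : Set Z} {f g : C(Z, A)}
    (H : (j.comp f).HomotopyRel (j.comp g) B) (hH : ∀ z, H z ∈ range j) :
    f.HomotopicRel g B := by
  obtain ⟨L, hL⟩ := hj.exists_continuousMap_lift H.toContinuousMap hH
  have hL' (z) : j (L z) = H z := hL z
  refine ⟨⟨⟨L, fun z => hj.injective ?_, fun z => hj.injective ?_⟩, fun t z hz => hj.injective ?_⟩⟩
  · exact (hL' _).trans (H.apply_zero z)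
  · exact (hL' _).trans (H.apply_one z)
  · exact (hL' _).trans (H.eq_fst t hz)

/-- An embedding is a weak homotopy equivalence if the target carries a continuous action by
scales in `(0, 1]` which preserves the source and moves every compact set into it. -/
theorem isWeakHomotopyEquiv_of_scaling (j : C(A, Y)) (hj : Topology.IsEmbedding j)
    (ρ : C(Ioc (0 : ℝ) 1 × Y, Y)) (hρ1 : ∀ y, ρ (1, y) = y)
    (hρj : ∀ c, ∀ y ∈ range j, ρ (c, y) ∈ range j)
    (hρK : ∀ K : Set Y, IsCompact K → ∃ ε, ∀ y ∈ K, ρ (ε, y) ∈ range j) :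
    IsWeakHomotopyEquiv j := by
  have hjoin (c : Ioc (0 : ℝ) 1) (y : Y) :
      ∃ γ : Path y (ρ (c, y)), ∀ t, ∃ d, γ t = ρ (d, y) := by
    have hc (t : I) : (1 - t * (1 - c) : ℝ) ∈ Ioc (0 : ℝ) 1 := by
      have h0 := c.2.1
      have h1 : 0 ≤ 1 - (c : ℝ) := by linarith [c.2.2]
      have h2 := mul_le_of_le_one_left h1 t.2.2
      have h3 := mul_nonneg t.2.1 h1
      constructor <;> linarith
    exact ⟨⟨⟨fun t => ρ (⟨_, hc t⟩, y), by fun_prop⟩, by simp [hρ1], by simp⟩,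
      fun t => ⟨⟨_, hc t⟩, rfl⟩⟩
  have hlift {a b : A} (γ : Path (j a) (j b)) (hγ : ∀ t, γ t ∈ range j) : Joined a b := by
    obtain ⟨L, hL⟩ := hj.exists_continuousMap_lift γ.toContinuousMap hγ
    have hL' (t) : j (L t) = γ t := hL t
    exact ⟨⟨L, hj.injective (by simp [hL']), hj.injective (by simp [hL'])⟩⟩
  refine ⟨⟨?_, ?_⟩, fun n x => ⟨?_, ?_⟩⟩
  · rintro ⟨a⟩ ⟨b⟩ h
    obtain ⟨γ⟩ : Joined (j a) (j b) := Quotient.exact h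
    obtain ⟨ε, hε⟩ := hρK (range γ) (isCompact_range γ.continuous)
    obtain ⟨a', ha'⟩ := hρj ε (j a) ⟨a, rfl⟩
    obtain ⟨b', hb'⟩ := hρj ε (j b) ⟨b, rfl⟩
    have hstep {a a' : A} (h : j a' = ρ (ε, j a)) : Joined a a' := by
      obtain ⟨δ, hδ⟩ := hjoin ε (j a)
      refine hlift (δ.cast rfl h) fun t => ?_
      obtain ⟨d, hd⟩ := hδ t
      exact (hd ▸ hρj d _ ⟨a, rfl⟩ : δ t ∈ range j)
    refine Quotient.sound (((hstep ha').trans ?_).trans (hstep hb').symm)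
    refine hlift ((γ.map (f := fun y => ρ (ε, y)) (by fun_prop)).cast ha' hb') fun t => ?_
    exact hε _ ⟨t, rfl⟩
  · rintro ⟨y⟩
    obtain ⟨ε, hε⟩ := hρK {y} isCompact_singleton
    obtain ⟨a, ha⟩ := hε y rfl
    obtain ⟨δ, -⟩ := hjoin ε y
    exact ⟨Quotient.mk _ a, Quotient.sound ⟨(δ.cast rfl ha).symm⟩⟩
  · rintro ⟨p⟩ ⟨q⟩ h
    obtain ⟨H⟩ : (j.comp p.1).HomotopicRel (j.comp q.1) (cubeBoundary (n + 1)) := Quotient.exact h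
    obtain ⟨ε, hε⟩ := hρK (range H) (isCompact_range H.continuous)
    obtain ⟨F, G, hF0, hG0, hFG, hFG1⟩ := exists_cube_collar (n + 1) ε
    have hpush (p : GenLoops (n + 1) A x) : ∃ p' : C(Fin (n + 1) → I, A),
        (∀ y, j (p' y) = ρ (G (1, y), j (p.1 (F (1, y))))) ∧
        p.1.HomotopicRel p' (cubeBoundary (n + 1)) := by
      obtain ⟨p', hp'⟩ := hj.exists_continuousMap_lift
        ⟨fun y => ρ (G (1, y), j (p.1 (F (1, y)))), by fun_prop⟩ fun y => hρj _ _ ⟨_, rfl⟩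
      refine ⟨p', hp', hj.homotopicRel_of_comp
        ⟨⟨⟨fun z => ρ (G z, j (p.1 (F z))), by fun_prop⟩, fun y => ?_, fun y => ?_⟩,
          fun t y hy => ?_⟩ fun z => hρj _ _ ⟨_, rfl⟩⟩
      · simp [hF0, hG0, hρ1]
      · exact (hp' y).symm
      · obtain ⟨h1, h2⟩ := hFG t y hy
        simp [h2, hρ1, p.2 _ h1, p.2 y hy]
    obtain ⟨p', hp', hpp'⟩ := hpush p
    obtain ⟨q', hq', hqq'⟩ := hpush q
    refine Quotient.sound ((hpp'.trans ?_).trans hqq'.symm)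
    have hHb (t) {y} (hy : y ∈ cubeBoundary (n + 1)) : H (t, y) = j x :=
      (H.eq_fst t hy).trans (congrArg j (p.2 y hy))
    refine hj.homotopicRel_of_comp
      ⟨⟨⟨fun z => ρ (G (1, z.2), H (z.1, F (1, z.2))), by fun_prop⟩, fun y => ?_, fun y => ?_⟩,
        fun t y hy => ?_⟩ fun z => ?_
    · simp [hp']
    · simp [hq']
    · obtain ⟨h1, -⟩ := hFG 1 y hy
      simp [hp', hHb t h1, p.2 _ h1]
    · obtain h | h := hFG1 z.2
      · exact (h ▸ hε _ ⟨_, rfl⟩ : ρ (G (1, z.2), H (z.1, F (1, z.2))) ∈ range j)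
      · exact hρj _ _ ⟨x, (hHb z.1 h).symm⟩
  · rintro ⟨p⟩
    obtain ⟨ε, hε⟩ := hρK (range p.1) (isCompact_range p.1.continuous)
    obtain ⟨F, G, hF0, hG0, hFG, hFG1⟩ := exists_cube_collar (n + 1) ε
    obtain ⟨q, hq⟩ := hj.exists_continuousMap_lift
        ⟨fun y => ρ (G (1, y), p.1 (F (1, y))), by fun_prop⟩ fun y => by
      obtain h | h := hFG1 y
      · exact (h ▸ hε _ ⟨_, rfl⟩ : ρ (G (1, y), p.1 (F (1, y))) ∈ range j)
      · exact hρj _ _ ⟨x, (p.2 _ h).symm⟩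
    simp only [ContinuousMap.coe_mk] at hq
    have hqb : ∀ y ∈ cubeBoundary (n + 1), q y = x := fun y hy => hj.injective <| by
      obtain ⟨h1, h2⟩ := hFG 1 y hy
      rw [hq, h2, hρ1, p.2 _ h1]
    refine ⟨Quotient.mk _ ⟨q, hqb⟩, Quotient.sound (ContinuousMap.HomotopicRel.symm
      ⟨⟨⟨⟨fun z => ρ (G z, p.1 (F z)), by fun_prop⟩, fun y => ?_, fun y => ?_⟩,
        fun t y hy => ?_⟩⟩)⟩
    · simp [hF0, hG0, hρ1]
    · simp [hq]
    · obtain ⟨h1, h2⟩ := hFG t y hy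
      simp [h2, hρ1, p.2 _ h1, p.2 y hy]

end CompressionCriterion

section LocalHolink

variable {P : Type*} [Preorder P] {X : Type*} [TopologicalSpace X] (s : X → P) (p : P) (x : X)

/-- Scaling of exit paths: `γ` is sent to `t ↦ γ (c * t)`. -/
def localHolinkScale : C(Ioc (0 : ℝ) 1 × LocalHolink s p x, LocalHolink s p x) where
  toFun z :=
    let m : C(I, I) := ⟨fun t => ⟨z.1, z.1.2.1.le, z.1.2.2⟩ * t, by fun_prop⟩
    have hm {t : I} (ht : t ≠ 0) : m t ≠ 0 :=
      mul_ne_zero (fun h => z.1.2.1.ne' (congrArg Subtype.val h)) ht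
    have hm0 : m 0 = 0 := mul_zero _
    ⟨⟨z.2.1.1.comp m, by simpa [hm0] using z.2.1.2.1,
      fun _ ht => z.2.1.2.2.1 _ (hm ht),
      fun _ _ ht ht' => z.2.1.2.2.2 _ _ (hm ht) (hm ht')⟩, by simpa [hm0] using z.2.2⟩
  continuous_toFun := by
    refine Continuous.subtype_mk (Continuous.subtype_mk
      (ContinuousMap.continuous_of_continuous_uncurry _ ?_) _) _
    have : Continuous fun w : (Ioc (0 : ℝ) 1 × LocalHolink s p x) × I =>
        w.1.2.1.1 (⟨w.1.1, w.1.1.2.1.le, w.1.1.2.2⟩ * w.2) := by fun_prop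
    exact this

lemma localHolinkStrat_scale (c : Ioc (0 : ℝ) 1) (γ : LocalHolink s p x) :
    localHolinkStrat s p x (localHolinkScale s p x (c, γ)) = localHolinkStrat s p x γ :=
  Subtype.ext (γ.1.2.2.2 _ _
    (mul_ne_zero (fun h => c.2.1.ne' (congrArg Subtype.val h)) I_one_ne_zero) I_one_ne_zero)

/-- The scaling of exit paths acts on generalized homotopy links of local homotopy links. -/
def holinkScale {m : ℕ} (J : Fin (m + 1) → {q : P // p < q}) :
    C(Ioc (0 : ℝ) 1 × Holink (localHolinkStrat s p x) J, Holink (localHolinkStrat s p x) J) where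
  toFun z := ⟨(localHolinkScale s p x).comp ((ContinuousMap.const _ z.1).prodMk z.2.1),
    fun d => (localHolinkStrat_scale s p x _ _).trans (z.2.2 d)⟩
  continuous_toFun := by
    refine Continuous.subtype_mk (ContinuousMap.continuous_of_continuous_uncurry _ ?_) _
    have : Continuous fun w : (Ioc (0 : ℝ) 1 × Holink (localHolinkStrat s p x) J) ×
        stdSimplex ℝ (Fin (m + 1)) => localHolinkScale s p x (w.1.1, w.1.2.1 w.2) := by fun_prop
    exact this

lemma isEmbedding_localHolinkCMap {Y : Type*} [TopologicalSpace Y] {sX : X → P} {sY : Y → P}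
    (w : C(X, Y)) (hwe : Topology.IsEmbedding w) (hw : ∀ x, sY (w x) = sX x) :
    Topology.IsEmbedding (localHolinkCMap w hw p x) := by
  refine .of_comp (localHolinkCMap w hw p x).continuous
    (continuous_subtype_val.comp continuous_subtype_val) ?_
  exact (ContinuousMap.isEmbedding_postcomp _ hwe).comp (Topology.IsEmbedding.subtypeVal.comp Topology.IsEmbedding.subtypeVal)

lemma isEmbedding_holinkCMap {Q Y : Type*} [TopologicalSpace Y] (sX : X → Q) (sY : Y → Q)
    (w : C(X, Y)) (hwe : Topology.IsEmbedding w) (hw : ∀ x, sY (w x) = sX x)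
    {m : ℕ} (J : Fin (m + 1) → Q) : Topology.IsEmbedding (holinkCMap sX sY w hw J) :=
  .of_comp (holinkCMap sX sY w hw J).continuous continuous_subtype_val
    ((ContinuousMap.isEmbedding_postcomp _ hwe).comp Topology.IsEmbedding.subtypeVal)

end LocalHolink

/-- **Local homotopy links are local.** Let `X` be a diagrammatically fibrant
stratified space over `P`, `p ∈ P`, `x ∈ X_p`, and `N ⊆ X` a neighborhood of `x`
with the induced stratification. Then the inclusion of local homotopy links
`Hol^s_p(N)_x → Hol^s_p(X)_x` is a diagrammatic equivalence over `P_{>p}`. -/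
theorem localHolink_nbhd_diag_equiv {P : Type} [PartialOrder P] {X : Type}
    [TopologicalSpace X] (s : X → P) (hs : AlexContinuous s) (hfib : DiagFibrant s)
    (p : P) (x : X) (hx : s x = p) (N : Set X) (hxN : x ∈ N) (hN : N ∈ nhds x) :
    IsDiagEquiv
      (localHolinkStrat (fun y : N => s y.1) p (⟨x, hxN⟩ : N))
      (localHolinkStrat s p
        ((⟨Subtype.val, continuous_subtype_val⟩ : C(N, X)) (⟨x, hxN⟩ : N)))
      (localHolinkCMap (⟨Subtype.val, continuous_subtype_val⟩ : C(N, X))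
        (fun _ => rfl) p (⟨x, hxN⟩ : N))
      (localHolinkCMap_strat _ _ p _) := by
  intro m J _
  set w : C(N, X) := ⟨Subtype.val, continuous_subtype_val⟩
  have hwe : Topology.IsEmbedding w := Topology.IsEmbedding.subtypeVal
  have hle := isEmbedding_localHolinkCMap (sX := fun y : N => s y.1) (sY := s) p ⟨x, hxN⟩ w hwe
    fun _ => rfl
  have hje := isEmbedding_holinkCMap _ _ _ hle (localHolinkCMap_strat w (fun _ => rfl) p ⟨x, hxN⟩) J
  have hrange (f : Holink (localHolinkStrat s p x) J) :
      f ∈ range (holinkCMap _ _ _ (localHolinkCMap_strat w (fun _ => rfl) p ⟨x, hxN⟩) J) ↔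
        ∀ d t, (f.1 d).1.1 t ∈ N := by
    constructor
    · rintro ⟨g, rfl⟩ d t
      exact ((g.1 d).1.1 t).2
    · intro h
      obtain ⟨g, hg⟩ := hle.exists_continuousMap_lift f.1 fun d =>
        ⟨⟨⟨⟨fun t => ⟨(f.1 d).1.1 t, h d t⟩, by fun_prop⟩, (f.1 d).1.2⟩, Subtype.ext (f.1 d).2⟩, rfl⟩
      refine ⟨⟨g, fun d => ?_⟩, Subtype.ext (ContinuousMap.ext hg)⟩
      rw [← f.2 d, ← hg d]
      rfl
  refine isWeakHomotopyEquiv_of_scaling _ hje (holinkScale s p x J) (fun f => ?_) (fun c f hf => ?_)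
    fun K hK => ?_
  · refine Subtype.ext (ContinuousMap.ext fun d => Subtype.ext (Subtype.ext
      (ContinuousMap.ext fun t => ?_)))
    exact congrArg (f.1 d).1.1 (one_mul t)
  · exact (hrange _).2 fun d t => (hrange f).1 hf d _
  · have hev : Continuous fun z : (Holink (localHolinkStrat s p x) J ×
        stdSimplex ℝ (Fin (m + 1))) × I => (z.1.1.1 z.1.2).1.1 z.2 := by fun_prop
    obtain ⟨U, V, -, hV, hKU, h0V, hUV⟩ := generalized_tube_lemma (hK.prod isCompact_univ)
      (isCompact_singleton (x := (0 : I))) (isOpen_interior.preimage hev)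
      (s := K ×ˢ univ) (n := _ ⁻¹' interior N) (by
        rintro ⟨⟨f, d⟩, t⟩ ⟨-, rfl⟩
        exact (congrArg (· ∈ interior N) (f.1 d).2).mpr (mem_interior_iff_mem_nhds.2 hN))
    obtain ⟨ε, hε0, hε⟩ := Metric.isOpen_iff.1 hV 0 (h0V rfl)
    have hδ : 0 < min (ε / 2) 1 := by positivity
    refine ⟨⟨min (ε / 2) 1, hδ, min_le_right _ _⟩, fun f hf => ?_⟩
    refine (hrange _).2 fun d t => interior_subset
      (hUV (a := ((f, d), _)) ⟨hKU ⟨hf, mem_univ d⟩, hε ?_⟩)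
    rw [Metric.mem_ball, Subtype.dist_eq, Real.dist_eq, Icc.coe_zero, sub_zero]
    refine (abs_of_nonneg (mul_nonneg hδ.le t.2.1)).trans_lt ?_
    refine (mul_le_of_le_one_right hδ.le t.2.2).trans_lt ?_
    exact (min_le_left _ _).trans_lt (half_lt_self hε0)
end
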